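/- arXiv:0805.0521 — 4 statements merged into one kernel-verified Lean document; each statement's English description precedes it below -/
import Mathlib

section
/- For every σ > 0, A > 0 and every α with 1/2 ≤ α ≤ 1, the capacity is lower-bounded as C(A, αA) ≥ (1/2)·log( 1 + A²/(2πeσ²) ). -/
open MeasureTheory ProbabilityTheory Real Filter Set
open scoped Classical Topology

/-- Kullback--Leibler divergence (in nats), valued in the extended reals:
`D(P ∥ R) = ∫ log (dP/dR) dP` if `P ≪ R` and the log-likelihood ratio is
`P`-integrable, and `+∞` otherwise. -/
noncomputable def klDiv {α : Type*} [MeasurableSpace α] (P R : Measure α) : EReal :=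
  if P ≪ R ∧ Integrable (llr P R) P then ((∫ x, llr P R x ∂P : ℝ) : EReal) else ⊤

/-- Joint law of `(X, Y)` where `X ~ Q` and `Y = X + Z` with `Z ~ N(0, σ²)`
independent of `X`. -/
noncomputable def jointLaw (σ : ℝ) (Q : Measure ℝ) : Measure (ℝ × ℝ) :=
  (Q.prod (gaussianReal 0 ⟨σ ^ 2, sq_nonneg σ⟩)).map (fun p => (p.1, p.1 + p.2))

/-- Mutual information `I(X;Y)` in nats: the KL divergence of the joint law of
`(X, Y)` from the product of its marginal laws. -/
noncomputable def mutualInfo (σ : ℝ) (Q : Measure ℝ) : EReal :=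
  klDiv (jointLaw σ Q) (((jointLaw σ Q).map Prod.fst).prod ((jointLaw σ Q).map Prod.snd))

/-- Capacity `C(A, E)` of the channel `Y = X + Z`, `Z ~ N(0, σ²)`, with peak-power
constraint `A` (i.e. `P(0 ≤ X ≤ A) = 1`) and average-power constraint `E[X] ≤ E`:
the supremum of the mutual information over all admissible input laws. -/
noncomputable def capacity (σ A E : ℝ) : EReal :=
  ⨆ Q ∈ {Q : Measure ℝ | IsProbabilityMeasure Q ∧ Q (Set.Icc 0 A) = 1 ∧
      ∫⁻ x, ENNReal.ofReal x ∂Q ≤ ENNReal.ofReal E}, mutualInfo σ Q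

lemma dv_aux {Ω : Type*} [MeasurableSpace Ω] (P S : Measure Ω) [IsProbabilityMeasure P]
    [IsProbabilityMeasure S] (g : Ω → ℝ) (hg : Measurable g) (hgP : Integrable g P)
    (B L : ℝ) (hB : 0 < B)
    (hR : ∫⁻ x, ENNReal.ofReal (rexp (g x)) ∂S ≤ ENNReal.ofReal B)
    (hL : L ≤ ∫ x, g x ∂P - Real.log B) : (L : EReal) ≤ klDiv P S := by
  unfold klDiv
  split_ifs with h
  · obtain ⟨hac, hint⟩ := h
    have hgR : Integrable (fun x => rexp (g x)) S := by
      refine ⟨(hg.exp).aestronglyMeasurable, ?_⟩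
      rw [hasFiniteIntegral_iff_ofReal (Eventually.of_forall fun x => (Real.exp_pos _).le)]
      exact hR.trans_lt ENNReal.ofReal_lt_top
    have hp := isProbabilityMeasure_tilted hgR
    have h1 := integral_llr_tilted_right hac hgP hgR hint
    have h2 := InformationTheory.integral_llr_add_sub_measure_univ_nonneg
      (hac.trans (absolutelyContinuous_tilted hgR)) (integrable_llr_tilted_right hac hgP hint hgR)
    simp only [probReal_univ, add_sub_cancel_right] at h2
    have h3 : ∫ x, rexp (g x) ∂S ≤ B := by
      rw [← ofReal_integral_eq_lintegral_ofReal hgR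
        (Eventually.of_forall fun x => (Real.exp_pos _).le)] at hR
      exact (ENNReal.ofReal_le_ofReal_iff hB.le).1 hR
    have h4 : Real.log (∫ x, rexp (g x) ∂S) ≤ Real.log B :=
      Real.log_le_log (integral_exp_pos hgR) h3
    rw [EReal.coe_le_coe_iff]
    linarith
  · exact le_top

lemma jointLaw_eq (σ : ℝ) (v : NNReal) (hv : (v : ℝ) = σ ^ 2) (Q : Measure ℝ) :
    jointLaw σ Q = (Q.prod (gaussianReal 0 v)).map (fun p => (p.1, p.1 + p.2)) := by
  have : v = ⟨σ ^ 2, sq_nonneg σ⟩ := Subtype.ext hv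
  subst this
  rfl

lemma mi_aux (σ : ℝ) (v : NNReal) (hv : (v : ℝ) = σ ^ 2) (Q : Measure ℝ) [IsProbabilityMeasure Q] (g : ℝ × ℝ → ℝ) (hg : Measurable g)
    (B L : ℝ) (hB : 0 < B) (K : ℝ → ℝ → ℝ)
    (hgP : Integrable (fun p : ℝ × ℝ => g (p.1, p.1 + p.2))
      (Q.prod (gaussianReal 0 v)))
    (hK : ∀ x x', ∫⁻ z, ENNReal.ofReal (rexp (g (x, x' + z)))
      ∂(gaussianReal 0 v) ≤ ENNReal.ofReal (K x x'))
    (hR : ∫⁻ x, ∫⁻ x', ENNReal.ofReal (K x x') ∂Q ∂Q ≤ ENNReal.ofReal B)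
    (hL : L ≤ ∫ p, g (p.1, p.1 + p.2) ∂(Q.prod (gaussianReal 0 v))
      - Real.log B) : (L : EReal) ≤ mutualInfo σ Q := by
  unfold mutualInfo
  have hm : Measurable (fun p : ℝ × ℝ => (p.1, p.1 + p.2)) := by fun_prop
  have hPp : IsProbabilityMeasure (jointLaw σ Q) := by
    rw [jointLaw_eq σ v hv]
    exact Measure.isProbabilityMeasure_map hm.aemeasurable
  have hP1 : IsProbabilityMeasure ((jointLaw σ Q).map Prod.fst) :=
    Measure.isProbabilityMeasure_map measurable_fst.aemeasurable
  have hP2 : IsProbabilityMeasure ((jointLaw σ Q).map Prod.snd) :=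
    Measure.isProbabilityMeasure_map measurable_snd.aemeasurable
  have hfst : (jointLaw σ Q).map Prod.fst = Q := by
    rw [jointLaw_eq σ v hv]
    rw [Measure.map_map measurable_fst hm]
    have : (Prod.fst ∘ fun p : ℝ × ℝ => (p.1, p.1 + p.2)) = Prod.fst := rfl
    rw [this, Measure.map_fst_prod]
    simp
  have hsnd : (jointLaw σ Q).map Prod.snd =
      (Q.prod (gaussianReal 0 v)).map (fun p => p.1 + p.2) := by
    rw [jointLaw_eq σ v hv]
    rw [Measure.map_map measurable_snd hm]
    rfl
  refine dv_aux _ _ g hg ?_ B L hB ?_ ?_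
  · rw [jointLaw_eq σ v hv]
    rw [integrable_map_measure hg.aestronglyMeasurable hm.aemeasurable]
    exact hgP
  · refine le_trans ?_ hR
    rw [lintegral_prod _ (by fun_prop), hfst, hsnd]
    refine lintegral_mono fun x => ?_
    rw [lintegral_map (by fun_prop) (by fun_prop), lintegral_prod _ (by fun_prop)]
    exact lintegral_mono fun x' => hK x x'
  · rw [jointLaw_eq σ v hv]
    rwa [integral_map hm.aemeasurable hg.aestronglyMeasurable]

lemma gauss_lin (σ t : ℝ) (v : NNReal) (hv : (v : ℝ) = σ ^ 2) : ∫⁻ z, ENNReal.ofReal (rexp (t * z))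
      ∂(gaussianReal 0 v) = ENNReal.ofReal (rexp (σ ^ 2 * t ^ 2 / 2)) := by
  rw [← ofReal_integral_eq_lintegral_ofReal (integrable_exp_mul_gaussianReal t)
        (Eventually.of_forall fun x => (Real.exp_pos _).le)]
  have := mgf_gaussianReal (p := gaussianReal 0 v) (X := id) (μ := 0)
    (v := v) (by simp) t
  simp only [mgf, id] at this
  rw [this, hv]
  simp

lemma gauss_quad (σ d : ℝ) (v : NNReal) (hv : (v : ℝ) = σ ^ 2) (hσ : 0 < σ) :
    ∫⁻ z, ENNReal.ofReal (rexp (-(d + z) ^ 2 / (2 * σ ^ 2)))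
      ∂(gaussianReal 0 v) =
      ENNReal.ofReal ((√2)⁻¹ * rexp (- d ^ 2 / (4 * σ ^ 2))) := by
  have hv0 : (v : NNReal) ≠ 0 := by
    intro h
    rw [h] at hv
    have : 0 < σ ^ 2 := by positivity
    simp at hv
    linarith
  have hi : Integrable (fun z => rexp (-(d + z) ^ 2 / (2 * σ ^ 2)))
      (gaussianReal 0 v) := by
    refine Integrable.of_bound (C := 1) (by fun_prop) (Eventually.of_forall fun z => ?_)
    rw [Real.norm_eq_abs, abs_of_pos (Real.exp_pos _), Real.exp_le_one_iff]
    exact div_nonpos_of_nonpos_of_nonneg (by nlinarith [sq_nonneg (d+z)]) (by positivity)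
  rw [← ofReal_integral_eq_lintegral_ofReal hi
        (Eventually.of_forall fun x => (Real.exp_pos _).le)]
  congr 1
  rw [integral_gaussianReal_eq_integral_smul hv0]
  have : ∀ z, gaussianPDFReal 0 v z • rexp (-(d + z) ^ 2 / (2 * σ ^ 2))
     = ((√(2 * π * σ ^ 2))⁻¹ * rexp (- d ^ 2 / (4 * σ ^ 2))) *
       (fun w => rexp (-(1 / σ ^ 2) * w ^ 2)) (z + d / 2) := by
    intro z
    simp only [gaussianPDFReal, smul_eq_mul, hv]
    rw [mul_assoc, mul_assoc _ (rexp _) (rexp _), ← Real.exp_add, ← Real.exp_add]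
    congr 2
    field_simp
    ring
  simp_rw [this]
  rw [integral_const_mul, integral_add_right_eq_self (μ := volume)
    (fun w => rexp (-(1 / σ ^ 2) * w ^ 2)), integral_gaussian]
  have : √(2 * π * σ ^ 2) = √2 * √(π / (1 / σ ^ 2)) := by
    rw [← Real.sqrt_mul (by norm_num)]
    congr 1
    field_simp
  rw [this]
  have : 0 < √(π / (1 / σ ^ 2)) := by positivity
  field_simp

lemma gauss_sq (σ : ℝ) (v : NNReal) (hv : (v : ℝ) = σ ^ 2) : Integrable (fun z : ℝ => z ^ 2) (gaussianReal 0 v) ∧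
    ∫ z, z ^ 2 ∂(gaussianReal 0 v) = σ ^ 2 := by
  constructor
  · exact (memLp_id_gaussianReal (μ := 0) (v := v) 2).integrable_sq
  · have := variance_id_gaussianReal (μ := 0) (v := v)
    rw [variance_of_integral_eq_zero (by fun_prop) (by simp)] at this
    rw [← hv]
    simpa using this

lemma binary_case (σ A E μ L : ℝ) (hσ : 0 < σ) (hA : 0 < A) (hE : A / 2 ≤ E)
    (hL : L ≤ μ * (A / (2 * σ)) -
      Real.log (rexp (μ ^ 2 / 2) * Real.cosh (μ * (A / (2 * σ))))) :
    (L : EReal) ≤ capacity σ A E := by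
  have hv : ((Real.toNNReal (σ ^ 2) : NNReal) : ℝ) = σ ^ 2 := Real.coe_toNNReal _ (sq_nonneg σ)
  set v := Real.toNNReal (σ ^ 2)
  have h2 : (2 : ENNReal)⁻¹ + 2⁻¹ = 1 := ENNReal.inv_two_add_inv_two
  set Q : Measure ℝ := (2 : ENNReal)⁻¹ • Measure.dirac 0 + (2 : ENNReal)⁻¹ • Measure.dirac A with hQ
  have hQp : IsProbabilityMeasure Q := ⟨by simp [hQ, h2]⟩
  have hhalf : ∀ r : ℝ, (2 : ENNReal)⁻¹ * ENNReal.ofReal r = ENNReal.ofReal (r / 2) := by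
    intro r
    rw [div_eq_inv_mul, ENNReal.ofReal_mul (by norm_num), ENNReal.ofReal_inv_of_pos (by norm_num)]
    simp
  have hlint : ∀ f : ℝ → ENNReal, ∫⁻ x, f x ∂Q = 2⁻¹ * f 0 + 2⁻¹ * f A := by
    intro f
    simp [hQ]
  unfold capacity
  refine le_iSup₂_of_le Q ⟨hQp, ?_, ?_⟩ ?_
  · have h0 : (0 : ℝ) ∈ Set.Icc 0 A := ⟨le_rfl, hA.le⟩
    have h1 : A ∈ Set.Icc 0 A := ⟨hA.le, le_rfl⟩
    simp [hQ, h2, hA.le]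
  · rw [hlint]
    simp only [ENNReal.ofReal_zero, mul_zero, zero_add]
    rw [hhalf]
    exact ENNReal.ofReal_le_ofReal hE
  · have hprod : Q.prod (gaussianReal 0 v) =
        (2 : ENNReal)⁻¹ • (gaussianReal 0 v).map (Prod.mk (0 : ℝ)) +
        (2 : ENNReal)⁻¹ • (gaussianReal 0 v).map (Prod.mk A) := by
      rw [hQ, Measure.add_prod, Measure.prod_smul_left, Measure.prod_smul_left, Measure.dirac_prod,
        Measure.dirac_prod]
    set g : ℝ × ℝ → ℝ := fun p => μ * (2 * p.1 - A) / (A * σ) * (p.2 - A / 2) with hg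
    have hgm : Measurable g := by fun_prop
    have hgm' : Measurable (fun p : ℝ × ℝ => g (p.1, p.1 + p.2)) := by fun_prop
    have hid : Integrable (fun z : ℝ => z) (gaussianReal 0 v) :=
      (memLp_id_gaussianReal (μ := 0) (v := v) 1).integrable (by norm_num)
    have hlin : ∀ x, Integrable (fun z => g (x, x + z)) (gaussianReal 0 v) := by
      intro x
      simp only [hg]
      exact ((integrable_const x).add hid |>.sub (integrable_const (A / 2))).const_mul _
    have hval : ∀ x, ∫ z, g (x, x + z) ∂(gaussianReal 0 v) =
        μ * (2 * x - A) / (A * σ) * (x - A / 2) := by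
      intro x
      have hxz : Integrable (fun z : ℝ => x + z) (gaussianReal 0 v) := (integrable_const x).add hid
      simp only [hg]
      rw [integral_const_mul, integral_sub hxz (integrable_const _),
        integral_add (integrable_const x) hid, integral_id_gaussianReal]
      simp
    have hmk : ∀ x : ℝ, Integrable (fun p : ℝ × ℝ => g (p.1, p.1 + p.2))
        ((2 : ENNReal)⁻¹ • (gaussianReal 0 v).map (Prod.mk x)) := by
      intro x
      refine Integrable.smul_measure ?_ (by simp)
      rw [integrable_map_measure hgm'.aestronglyMeasurable (by fun_prop)]
      exact hlin x
    have hmv : ∀ x : ℝ, ∫ p, g (p.1, p.1 + p.2)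
        ∂((2 : ENNReal)⁻¹ • (gaussianReal 0 v).map (Prod.mk x)) =
        2⁻¹ * (μ * (2 * x - A) / (A * σ) * (x - A / 2)) := by
      intro x
      rw [integral_smul_measure, integral_map (by fun_prop) hgm'.aestronglyMeasurable]
      simp only
      rw [hval x]
      simp
    refine mi_aux σ v hv Q g hgm (rexp (μ ^ 2 / 2) * Real.cosh (μ * (A / (2 * σ)))) L
      (mul_pos (Real.exp_pos _) (Real.cosh_pos _))
      (fun x x' => rexp (μ * (2 * x - A) / (A * σ) * (x' - A / 2)) *
        rexp (σ ^ 2 * (μ * (2 * x - A) / (A * σ)) ^ 2 / 2)) ?_ ?_ ?_ ?_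
    · rw [hprod]
      exact (hmk 0).add_measure (hmk A)
    · intro x x'
      apply le_of_eq
      rw [ENNReal.ofReal_mul (Real.exp_pos _).le, ← gauss_lin σ _ v hv,
        ← lintegral_const_mul _ (by fun_prop)]
      refine lintegral_congr fun z => ?_
      rw [← ENNReal.ofReal_mul (Real.exp_pos _).le, ← Real.exp_add]
      congr 2
      simp only [hg]
      ring
    · rw [hlint, hlint, hlint, hhalf, hhalf, hhalf, hhalf, ← ENNReal.ofReal_add (by positivity)
        (by positivity), ← ENNReal.ofReal_add (by positivity) (by positivity), hhalf, hhalf,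
        ← ENNReal.ofReal_add (by positivity) (by positivity)]
      apply ENNReal.ofReal_le_ofReal
      apply le_of_eq
      have e1 : σ ^ 2 * (μ * (2 * 0 - A) / (A * σ)) ^ 2 / 2 = μ ^ 2 / 2 := by field_simp; ring
      have e2 : σ ^ 2 * (μ * (2 * A - A) / (A * σ)) ^ 2 / 2 = μ ^ 2 / 2 := by field_simp; ring
      have e3 : μ * (2 * 0 - A) / (A * σ) * (0 - A / 2) = μ * (A / (2 * σ)) := by field_simp; ring
      have e4 : μ * (2 * 0 - A) / (A * σ) * (A - A / 2) = -(μ * (A / (2 * σ))) := by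
        field_simp; ring
      have e5 : μ * (2 * A - A) / (A * σ) * (0 - A / 2) = -(μ * (A / (2 * σ))) := by
        field_simp; ring
      have e6 : μ * (2 * A - A) / (A * σ) * (A - A / 2) = μ * (A / (2 * σ)) := by
        field_simp; ring
      rw [e1, e2, e3, e4, e5, e6, Real.cosh_eq]
      ring
    · rw [hprod, integral_add_measure (hmk 0) (hmk A), hmv, hmv]
      refine hL.trans (le_of_eq ?_)
      congr 1
      field_simp
      ring

lemma num_bin (a : ℝ) (ha : 0 < a) (ha2 : a ≤ 2.7) :
    ∃ μ : ℝ, 1 / 2 * Real.log (1 + 4 * a ^ 2 / (2 * π * rexp 1)) ≤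
      μ * a - Real.log (rexp (μ ^ 2 / 2) * Real.cosh (μ * a)) := by
  have hpe : 8.539 < π * rexp 1 := by
    have h1 := Real.pi_gt_d6
    have h2 := Real.exp_one_gt_d9
    nlinarith
  have hle : 4 * a ^ 2 / (2 * π * rexp 1) ≤ 0.23425 * a ^ 2 := by
    rw [div_le_iff₀ (by positivity)]
    nlinarith [sq_nonneg a, mul_le_mul_of_nonneg_left hpe.le (sq_nonneg a)]
  have hpos : 0 ≤ 4 * a ^ 2 / (2 * π * rexp 1) := by positivity
  rcases le_or_gt a 1.8 with h | h
  · refine ⟨a / (1 + a ^ 2), ?_⟩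
    set μ := a / (1 + a ^ 2) with hμ
    rw [Real.log_mul (Real.exp_pos _).ne' (Real.cosh_pos _).ne', Real.log_exp]
    have h1 : Real.log (Real.cosh (μ * a)) ≤ (μ * a) ^ 2 / 2 := by
      rw [← Real.log_exp ((μ * a) ^ 2 / 2)]
      exact Real.log_le_log (Real.cosh_pos _) (Real.cosh_le_exp_half_sq _)
    have h2 : Real.log (1 + 4 * a ^ 2 / (2 * π * rexp 1)) ≤ 0.23425 * a ^ 2 := by
      have := Real.log_le_sub_one_of_pos (x := 1 + 4 * a ^ 2 / (2 * π * rexp 1)) (by positivity)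
      linarith
    have h3 : μ * a - (μ ^ 2 / 2 + (μ * a) ^ 2 / 2) = 1 / 2 * (a ^ 2 / (1 + a ^ 2)) := by
      rw [hμ]; field_simp; ring
    have h4 : 0.23425 * a ^ 2 ≤ a ^ 2 / (1 + a ^ 2) := by
      rw [le_div_iff₀ (by positivity)]
      have : a ^ 2 ≤ 3.24 := by nlinarith
      nlinarith [sq_nonneg a]
    linarith
  · refine ⟨0.45, ?_⟩
    have key : ∀ b c q : ℝ, b ≤ a → a ≤ c → 0 < q → q ≤ rexp (0.9 * b) →
        (1 + 0.23425 * c ^ 2) * (1 + q⁻¹) ^ 2 * 1.2245 ≤ 4 →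
        1 / 2 * Real.log (1 + 4 * a ^ 2 / (2 * π * rexp 1)) ≤
        0.45 * a - Real.log (rexp ((0.45 : ℝ) ^ 2 / 2) * Real.cosh (0.45 * a)) := by
      intro b c q hb hc hq hqe hfin
      have hcosh : Real.cosh (0.45 * a) ≤ rexp (0.45 * a) * ((1 + q⁻¹) / 2) := by
        have : rexp (-(0.45 * a)) ≤ rexp (0.45 * a) * q⁻¹ := by
          rw [← div_eq_mul_inv, le_div_iff₀ hq]
          calc rexp (-(0.45 * a)) * q ≤ rexp (-(0.45 * a)) * rexp (0.9 * a) := by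
                gcongr
                exact hqe.trans (Real.exp_le_exp.2 (by linarith))
            _ = rexp (0.45 * a) := by rw [← Real.exp_add]; ring_nf
        rw [Real.cosh_eq]
        linarith
      have hq1 : 0 < (1 + q⁻¹) / 2 := by positivity
      rw [Real.log_mul (Real.exp_pos _).ne' (Real.cosh_pos _).ne', Real.log_exp]
      have h1 : Real.log (Real.cosh (0.45 * a)) ≤ 0.45 * a + Real.log ((1 + q⁻¹) / 2) := by
        have := Real.log_le_log (Real.cosh_pos _) hcosh
        rwa [Real.log_mul (Real.exp_pos _).ne' hq1.ne', Real.log_exp] at this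
      have he : rexp (0.2025) ≤ 1.2245 := by
        have := Real.exp_bound' (x := 0.2025) (by norm_num) (by norm_num) (n := 5) (by norm_num)
        refine this.trans ?_
        norm_num [Finset.sum_range_succ, Nat.factorial]
      have h2 : Real.log (1 + 4 * a ^ 2 / (2 * π * rexp 1)) + 0.2025 +
          2 * Real.log ((1 + q⁻¹) / 2) ≤ 0 := by
        have e : Real.log ((1 + 4 * a ^ 2 / (2 * π * rexp 1)) * rexp 0.2025 *
          ((1 + q⁻¹) / 2) ^ 2) = Real.log (1 + 4 * a ^ 2 / (2 * π * rexp 1)) + 0.2025 +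
          2 * Real.log ((1 + q⁻¹) / 2) := by
          rw [Real.log_mul (by positivity) (by positivity), Real.log_mul (by positivity)
            (by positivity), Real.log_exp, Real.log_pow]
          norm_num
        rw [← e]
        apply Real.log_nonpos (by positivity)
        have hac : a ^ 2 ≤ c ^ 2 := by gcongr
        calc (1 + 4 * a ^ 2 / (2 * π * rexp 1)) * rexp 0.2025 * ((1 + q⁻¹) / 2) ^ 2
            ≤ (1 + 0.23425 * c ^ 2) * 1.2245 * ((1 + q⁻¹) / 2) ^ 2 := by
              gcongr
              linarith
          _ ≤ 1 := by linarith
      norm_num at h2 h1 ⊢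
      linarith
    have hexp : ∀ x : ℝ, 0 ≤ x → 
        (∑ i ∈ Finset.range 8, x ^ i / (i.factorial : ℝ)) ≤ rexp x := fun x hx =>
      Real.sum_le_exp_of_nonneg hx 8
    rcases le_or_gt a 2.3 with h3 | h3
    · refine key 1.8 2.3 5.04 h.le h3 (by norm_num) ((le_trans ?_ (hexp _ (by norm_num)))) ?_ <;>
        norm_num [Finset.sum_range_succ, Nat.factorial]
    rcases le_or_gt a 2.55 with h4 | h4
    · refine key 2.3 2.55 7.91 h3.le h4 (by norm_num) ((le_trans ?_ (hexp _ (by norm_num)))) ?_ <;>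
        norm_num [Finset.sum_range_succ, Nat.factorial]
    rcases le_or_gt a 2.65 with h5 | h5
    · refine key 2.55 2.65 9.88 h4.le h5 (by norm_num) ((le_trans ?_ (hexp _ (by norm_num)))) ?_ <;>
        norm_num [Finset.sum_range_succ, Nat.factorial]
    · refine key 2.65 2.7 10.8 h5.le ha2 (by norm_num) ((le_trans ?_ (hexp _ (by norm_num)))) ?_ <;>
        norm_num [Finset.sum_range_succ, Nat.factorial]

lemma unif_int (σ A : ℝ) (hσ : 0 < σ) (hA : 0 < A) :
    ∫ x in (0 : ℝ)..A, ∫ x' in (0 : ℝ)..A, rexp (-(x' - x) ^ 2 / (4 * σ ^ 2)) ≤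
      2 * √π * σ * A - 4 * σ ^ 2 * (1 - rexp (-A ^ 2 / (4 * σ ^ 2))) := by
  set h : ℝ → ℝ := fun u => rexp (-u ^ 2 / (4 * σ ^ 2)) with hh
  have hc : Continuous h := by fun_prop
  set H : ℝ → ℝ := fun x => ∫ u in (0 : ℝ)..x, h u with hH
  have hint : ∀ a b, IntervalIntegrable h volume a b := fun a b => hc.intervalIntegrable a b
  have hHd : ∀ x, HasDerivAt H (h x) x := fun x =>
    intervalIntegral.integral_hasDerivAt_right (hint _ _)
      (hc.stronglyMeasurableAtFilter _ _) hc.continuousAt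
  have hHc : Continuous H := continuous_iff_continuousAt.2 fun x => (hHd x).continuousAt
  have heven : ∀ u, h (-u) = h u := by intro u; simp [hh]
  have hinner : ∀ x, ∫ x' in (0 : ℝ)..A, rexp (-(x' - x) ^ 2 / (4 * σ ^ 2)) = H x + H (A - x) := by
    intro x
    have e1 : ∫ x' in (0 : ℝ)..A, h (x' - x) = ∫ u in (0 - x)..(A - x), h u :=
      intervalIntegral.integral_comp_sub_right h x
    change ∫ x' in (0 : ℝ)..A, h (x' - x) = _
    rw [e1, ← intervalIntegral.integral_add_adjacent_intervals (hint _ 0) (hint 0 _)]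
    congr 1
    have e2 : ∫ u in (0 : ℝ)..x, h (-u) = ∫ u in (-x)..(-0), h u :=
      intervalIntegral.integral_comp_neg h
    simp only [heven] at e2
    rw [hH]
    simp only [zero_sub]
    rw [e2]
    simp
  simp_rw [hinner]
  rw [intervalIntegral.integral_add (hHc.intervalIntegrable _ _)
    ((show Continuous fun x => H (A - x) by fun_prop).intervalIntegrable _ _)]
  have e3 : ∫ x in (0 : ℝ)..A, H (A - x) = ∫ x in (0 : ℝ)..A, H x := by
    rw [intervalIntegral.integral_comp_sub_left H A]
    simp
  rw [e3]
  have e4 : ∫ x in (0 : ℝ)..A, H x = (A * H A + 2 * σ ^ 2 * h A) - (0 * H 0 + 2 * σ ^ 2 * h 0) := by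
    refine intervalIntegral.integral_eq_sub_of_hasDerivAt
      (f := fun x => x * H x + 2 * σ ^ 2 * h x) (fun x _ => ?_) (hHc.intervalIntegrable _ _)
    have hd : HasDerivAt h (h x * (-(2 * x) / (4 * σ ^ 2))) x := by
      have : HasDerivAt (fun u : ℝ => -u ^ 2 / (4 * σ ^ 2)) (-(2 * x) / (4 * σ ^ 2)) x := by
        have := ((hasDerivAt_pow 2 x).neg).div_const (4 * σ ^ 2)
        simpa using this
      exact this.exp
    convert! ((hasDerivAt_id x).mul (hHd x)).add (hd.const_mul (2 * σ ^ 2)) using 1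
    simp only [id]
    field_simp
    ring
  rw [e4]
  have h0 : h 0 = 1 := by simp [hh]
  have hHA : H A ≤ √π * σ := by
    rw [hH]
    simp only
    rw [intervalIntegral.integral_of_le hA.le]
    have e5 : ∀ u, h u = rexp (-(1 / (4 * σ ^ 2)) * u ^ 2) := by
      intro u; simp only [hh]; congr 1; ring
    have e6 : ∫ u in Set.Ioi (0 : ℝ), h u = √π * σ := by
      simp_rw [e5]
      rw [integral_gaussian_Ioi]
      have : π / (1 / (4 * σ ^ 2)) = π * (2 * σ) ^ 2 := by field_simp; ring
      rw [this, Real.sqrt_mul Real.pi_pos.le, Real.sqrt_sq (by positivity)]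
      ring
    rw [← e6]
    refine setIntegral_mono_set ?_ ?_ ?_
    · have := (integrable_exp_neg_mul_sq (b := 1 / (4 * σ ^ 2)) (by positivity)).integrableOn
        (s := Set.Ioi 0)
      refine this.congr_fun (fun u _ => (e5 u).symm) measurableSet_Ioi
    · exact Eventually.of_forall fun u => (Real.exp_pos _).le
    · exact Eventually.of_forall fun u hu => hu.1
  rw [h0]
  have : A * H A ≤ A * (√π * σ) := by gcongr
  change _ ≤ 2 * √π * σ * A - 4 * σ ^ 2 * (1 - h A)
  linarith

lemma unif_case (σ A E B L : ℝ) (hσ : 0 < σ) (hA : 0 < A) (hE : A / 2 ≤ E) (hB : 0 < B)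
    (hB2 : (√2)⁻¹ * (2 * √π * σ * A - 4 * σ ^ 2 * (1 - rexp (-A ^ 2 / (4 * σ ^ 2)))) ≤ B * A ^ 2)
    (hL : L ≤ - 1 / 2 - Real.log B) :
    (L : EReal) ≤ capacity σ A E := by
  have hv : ((Real.toNNReal (σ ^ 2) : NNReal) : ℝ) = σ ^ 2 := Real.coe_toNNReal _ (sq_nonneg σ)
  set v := Real.toNNReal (σ ^ 2)
  set Q : Measure ℝ := (ENNReal.ofReal A)⁻¹ • (volume.restrict (Set.Icc 0 A)) with hQ
  have hA0 : ENNReal.ofReal A ≠ 0 := by simpa using hA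
  have hQI : Q (Set.Icc 0 A) = 1 := by
    simp [hQ, ENNReal.inv_mul_cancel hA0 ENNReal.ofReal_ne_top]
  have hQp : IsProbabilityMeasure Q := ⟨by
    simp [hQ, ENNReal.inv_mul_cancel hA0 ENNReal.ofReal_ne_top]⟩
  have hlint : ∀ f : ℝ → ℝ, Continuous f → (∀ x ∈ Set.Icc 0 A, 0 ≤ f x) →
      ∫⁻ x, ENNReal.ofReal (f x) ∂Q = ENNReal.ofReal (A⁻¹ * ∫ x in (0 : ℝ)..A, f x) := by
    intro f hf h0
    rw [hQ, lintegral_smul_measure, ENNReal.ofReal_mul (by positivity),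
      ENNReal.ofReal_inv_of_pos hA, intervalIntegral.integral_of_le hA.le,
      ← integral_Icc_eq_integral_Ioc, ofReal_integral_eq_lintegral_ofReal
        (hf.integrableOn_Icc) (ae_restrict_of_forall_mem measurableSet_Icc h0), smul_eq_mul]
  unfold capacity
  refine le_iSup₂_of_le Q ⟨hQp, hQI, ?_⟩ ?_
  · rw [hlint (fun x => x) continuous_id (fun x hx => hx.1)]
    apply ENNReal.ofReal_le_ofReal
    rw [integral_id]
    refine le_trans (le_of_eq ?_) hE
    field_simp
    ring
  · set g : ℝ × ℝ → ℝ := fun p => -(p.2 - p.1) ^ 2 / (2 * σ ^ 2) with hg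
    have hgm : Measurable g := by fun_prop
    obtain ⟨hs1, hs2⟩ := gauss_sq σ v hv
    have hgz : (fun p : ℝ × ℝ => g (p.1, p.1 + p.2)) =
        fun p : ℝ × ℝ => (1 : ℝ) * (-p.2 ^ 2 / (2 * σ ^ 2)) := by
      funext p; simp [hg]
    have hz : Integrable (fun z : ℝ => -z ^ 2 / (2 * σ ^ 2)) (gaussianReal 0 v) :=
      hs1.neg.div_const _
    refine mi_aux σ v hv Q g hgm B L hB
      (fun x x' => (√2)⁻¹ * rexp (-(x' - x) ^ 2 / (4 * σ ^ 2))) ?_ ?_ ?_ ?_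
    · rw [hgz]
      exact (integrable_const (1 : ℝ)).mul_prod hz
    · intro x x'
      rw [← gauss_quad σ (x' - x) v hv hσ]
      apply le_of_eq
      refine lintegral_congr fun z => ?_
      simp only [hg]
      congr 4
      ring
    · have hi : ∀ x, ∫⁻ x', ENNReal.ofReal ((√2)⁻¹ * rexp (-(x' - x) ^ 2 / (4 * σ ^ 2))) ∂Q =
          ENNReal.ofReal (A⁻¹ * ((√2)⁻¹ * ∫ x' in (0 : ℝ)..A,
            rexp (-(x' - x) ^ 2 / (4 * σ ^ 2)))) := by
        intro x
        rw [hlint _ (by fun_prop) (fun x _ => by positivity), intervalIntegral.integral_const_mul]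
      simp_rw [hi]
      rw [hlint _ ?_ ?_, intervalIntegral.integral_const_mul, intervalIntegral.integral_const_mul]
      · apply ENNReal.ofReal_le_ofReal
        have := unif_int σ A hσ hA
        have h5 : (√2)⁻¹ * ∫ x in (0 : ℝ)..A, ∫ x' in (0 : ℝ)..A,
            rexp (-(x' - x) ^ 2 / (4 * σ ^ 2)) ≤ B * A ^ 2 := by
          refine le_trans ?_ hB2
          gcongr
        calc _ ≤ A⁻¹ * (A⁻¹ * (B * A ^ 2)) := by gcongr
          _ = B := by field_simp
      · refine continuous_const.mul (continuous_const.mul ?_)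
        exact intervalIntegral.continuous_parametric_intervalIntegral_of_continuous'
          (by fun_prop) 0 A
      · intro x _
        have : 0 ≤ ∫ x' in (0 : ℝ)..A, rexp (-(x' - x) ^ 2 / (4 * σ ^ 2)) :=
          intervalIntegral.integral_nonneg hA.le fun u _ => (Real.exp_pos _).le
        positivity
    · rw [hgz, integral_prod_mul (fun _ => (1 : ℝ)) (fun z : ℝ => -z ^ 2 / (2 * σ ^ 2)),
        integral_div, integral_neg, hs2]
      simp only [integral_const, probReal_univ, smul_eq_mul]
      refine hL.trans (le_of_eq ?_)
      field_simp

lemma num_unif (s : ℝ) (hs : 5.4 ≤ s) :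
    1 / 2 * Real.log (1 + s ^ 2 / (2 * π * rexp 1)) ≤
      - 1 / 2 - Real.log ((√2)⁻¹ * (2 * √π * s - 3.997) / s ^ 2) := by
  have hp1 := Real.pi_gt_d6
  have hp2 := Real.pi_lt_d6
  have he1 := Real.exp_one_gt_d9
  have he2 := Real.exp_one_lt_d9
  set k := √π with hk
  have hk2 : k ^ 2 = π := Real.sq_sqrt Real.pi_pos.le
  have hk0 : 0 ≤ k := Real.sqrt_nonneg _
  have hk1 : 1.77245 ≤ k := by
    apply Real.le_sqrt_of_sq_le; norm_num at hp1 ⊢; linarith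
  have hs0 : 0 < s := by linarith
  have hnum : 0 < 2 * k * s - 3.997 := by nlinarith
  have hden : 0 < 2 * π * rexp 1 := by positivity
  set m := 2 * π * rexp 1 with hm
  have hm1 : m ≤ 17.0795 := by
    rw [hm]
    nlinarith [mul_le_mul hp2.le he2.le (Real.exp_pos 1).le (by norm_num)]
  set b := (√2)⁻¹ * (2 * k * s - 3.997) / s ^ 2 with hb
  have hb0 : 0 < b := by positivity
  have hb2 : b ^ 2 = (2 * k * s - 3.997) ^ 2 / (2 * s ^ 4) := by
    rw [hb, div_pow, mul_pow, inv_pow, Real.sq_sqrt (by norm_num)]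
    field_simp
  have key : (2 * k * s - 3.997) ^ 2 * (m + s ^ 2) ≤ 4 * k ^ 2 * s ^ 4 := by
    have hpi' : k ^ 2 ≤ 3.141593 := by rw [hk2]; norm_num at hp2 ⊢; linarith
    obtain ⟨t, ht, rfl⟩ : ∃ t, 0 ≤ t ∧ s = 5.4 + t := ⟨s - 5.4, by linarith, by ring⟩
    have h1 : (2 * k * (5.4 + t) - 3.997) ^ 2 * m ≤
        (2 * k * (5.4 + t) - 3.997) ^ 2 * 17.0795 := by gcongr
    have h2 := mul_le_mul_of_nonneg_left hpi' (sq_nonneg (5.4 + t))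
    have h3 := mul_le_mul_of_nonneg_left hk1
      (show (0 : ℝ) ≤ (5.4 + t) ^ 3 + 17.0795 * (5.4 + t) by positivity)
    have h4 : 0 ≤ 4 * 3.997 * (((5.4 + t) ^ 3 + 17.0795 * (5.4 + t)) * 1.77245) -
        3.997 ^ 2 * (5.4 + t) ^ 2 - 17.0795 * 4 * ((5.4 + t) ^ 2 * 3.141593) -
        17.0795 * 3.997 ^ 2 := by
      have : 0 ≤ t ^ 2 := by positivity
      have : 0 ≤ t ^ 3 := by positivity
      ring_nf
      linarith
    linarith
  have main : (1 + s ^ 2 / m) * rexp 1 * b ^ 2 ≤ 1 := by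
    rw [hb2]
    have : (1 + s ^ 2 / m) * rexp 1 * ((2 * k * s - 3.997) ^ 2 / (2 * s ^ 4)) =
        ((2 * k * s - 3.997) ^ 2 * (m + s ^ 2)) * rexp 1 / (m * (2 * s ^ 4)) := by
      field_simp
    rw [this, div_le_one (by positivity)]
    calc _ ≤ (4 * k ^ 2 * s ^ 4) * rexp 1 := by gcongr
      _ = m * (2 * s ^ 4) := by rw [hk2, hm]; ring
  have hlog := Real.log_nonpos (by positivity) main
  rw [Real.log_mul (by positivity) (by positivity), Real.log_mul (by positivity) (by positivity),
    Real.log_exp, Real.log_pow] at hlog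
  push_cast at hlog
  linarith

theorem capacity_lower_bound_weak (σ A α : ℝ) (hσ : 0 < σ) (hA : 0 < A)
    (hα₁ : 1 / 2 ≤ α) (hα₂ : α ≤ 1) :
    ((1 / 2 * Real.log (1 + A ^ 2 / (2 * π * rexp 1 * σ ^ 2)) : ℝ) : EReal) ≤
      capacity σ A (α * A) := by
  have hE : A / 2 ≤ α * A := by nlinarith
  rcases le_or_gt (A / (2 * σ)) 2.7 with h | h
  · obtain ⟨μ, hμ⟩ := num_bin (A / (2 * σ)) (by positivity) h
    refine binary_case σ A (α * A) μ _ hσ hA hE (le_trans (le_of_eq ?_) hμ)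
    congr 3
    field_simp
    ring
  · have hs : 5.4 ≤ A / σ := by
      have : A / σ = 2 * (A / (2 * σ)) := by field_simp
      rw [this]; linarith
    have hn := num_unif (A / σ) hs
    have hAs : A = (A / σ) * σ := by field_simp
    have hpi : 1 ≤ √π := Real.one_le_sqrt.2 (by linarith [Real.pi_gt_three])
    have hnum : 0 < 2 * √π * (A / σ) - 3.997 := by nlinarith
    refine unif_case σ A (α * A) _ _ hσ hA hE (by positivity) ?_ (le_trans (le_of_eq ?_) hn)
    · have hexp : rexp (-A ^ 2 / (4 * σ ^ 2)) ≤ 0.00075 := by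
        have e : -A ^ 2 / (4 * σ ^ 2) = -((A / σ) ^ 2 / 4) := by field_simp
        have h7 : 7.29 ≤ (A / σ) ^ 2 / 4 := by nlinarith
        rw [e, Real.exp_neg]
        have h8 : 1340 ≤ rexp ((A / σ) ^ 2 / 4) := by
          calc (1340 : ℝ) ≤ (2.718) ^ 7 * (0.29 + 1) := by norm_num
            _ ≤ (rexp 1) ^ 7 * rexp 0.29 := by
              gcongr
              · linarith [Real.exp_one_gt_d9]
              · exact Real.add_one_le_exp _
            _ = rexp 7.29 := by rw [← Real.exp_nat_mul, ← Real.exp_add]; norm_num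
            _ ≤ _ := Real.exp_le_exp.2 h7
        calc _ ≤ (1340 : ℝ)⁻¹ := by gcongr
          _ ≤ _ := by norm_num
      have e : (√2)⁻¹ * (2 * √π * (A / σ) - 3.997) / (A / σ) ^ 2 * A ^ 2 =
        (√2)⁻¹ * (2 * √π * σ * A - 3.997 * σ ^ 2) := by field_simp
      rw [e]
      refine mul_le_mul_of_nonneg_left ?_ (by positivity)
      nlinarith [mul_le_mul_of_nonneg_left hexp (sq_nonneg σ)]
    · congr 3
      field_simp
end

section
/- For every σ > 0, A > 0, every α with 1/2 ≤ α ≤ 1, and every free parameter δ > 0, the capacity is upper-bounded as C(A, αA) ≤ (1 − 2Q((δ + A/2)/σ)) · log( (A + 2δ) / (σ·√(2π)·(1 − 2Q(δ/σ))) ) − 1/2 + Q(δ/σ) + (δ/(√(2π)σ))·e^{−δ²/(2σ²)}. -/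
open MeasureTheory ProbabilityTheory Real Filter Set
open scoped Classical Topology

/-- The Gaussian Q-function `Q(ξ) = ∫_ξ^∞ (1/√(2π)) e^{−t²/2} dt`. -/
noncomputable def Qf (ξ : ℝ) : ℝ := ∫ t in Set.Ioi ξ, (1 / Real.sqrt (2 * π)) * rexp (-t ^ 2 / 2)

noncomputable def ph (t : ℝ) : ℝ := (1 / Real.sqrt (2 * π)) * rexp (-t ^ 2 / 2)

noncomputable abbrev gam : Measure ℝ := gaussianReal 0 1

lemma ph_eq : ph = gaussianPDFReal 0 1 := by
  ext t
  simp [ph, gaussianPDFReal]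

lemma ph_pos (t : ℝ) : 0 < ph t := by
  unfold ph; positivity

lemma ph_integrable : Integrable ph := by
  rw [ph_eq]; exact integrable_gaussianPDFReal 0 1

lemma ph_continuous : Continuous ph := by unfold ph; fun_prop

lemma ph_neg (t : ℝ) : ph (-t) = ph t := by simp [ph]

lemma ph_anti {s t : ℝ} (hs : 0 ≤ s) (h : s ≤ t) : ph t ≤ ph s := by
  unfold ph
  have : s ^ 2 ≤ t ^ 2 := by gcongr
  gcongr

lemma Qf_eq (ξ : ℝ) : Qf ξ = ∫ t in Ioi ξ, ph t := rfl

lemma Qf_sub (u w : ℝ) : Qf u - Qf w = ∫ t in u..w, ph t := by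
  rw [Qf_eq, Qf_eq, intervalIntegral.integral_Ioi_sub_Ioi' ph_integrable.integrableOn ph_integrable.integrableOn]

lemma Qf_zero : Qf 0 = 1 / 2 := by
  have h1 : ∫ t, ph t = 1 := by
    rw [ph_eq]; exact integral_gaussianPDFReal_eq_one 0 one_ne_zero
  have h2 : ∫ t in Iic (0:ℝ), ph t = Qf 0 := by
    have := integral_comp_neg_Iic (0:ℝ) ph
    simp only [ph_neg, neg_zero] at this
    rw [this, Qf_eq]
  have h3 := intervalIntegral.integral_Iic_add_Ioi (b := (0:ℝ)) ph_integrable.integrableOn ph_integrable.integrableOn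
  rw [h1, h2, ← Qf_eq] at h3
  linarith

lemma ph_zero : ph 0 = 1 / Real.sqrt (2 * π) := by simp [ph]

lemma Qf_sub_ge {u w : ℝ} (hu : 0 ≤ u) (h : u ≤ w) : (w - u) * ph w ≤ Qf u - Qf w := by
  rw [Qf_sub]
  have := intervalIntegral.integral_mono_on (μ := volume) h (f := fun _ => ph w) (g := ph) intervalIntegrable_const
    (ph_continuous.intervalIntegrable _ _) (fun x hx => ph_anti (hu.trans hx.1) hx.2)
  simpa using this

lemma Qf_sub_le {u w : ℝ} (hu : 0 ≤ u) (h : u ≤ w) : Qf u - Qf w ≤ (w - u) * ph u := by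
  rw [Qf_sub]
  have := intervalIntegral.integral_mono_on (μ := volume) h (g := fun _ => ph u) (f := ph)
    (ph_continuous.intervalIntegrable _ _) intervalIntegrable_const (fun x hx => ph_anti hu hx.1)
  simpa using this

lemma Qf_mid {a b : ℝ} (ha : 0 ≤ a) (hb : 0 ≤ b) : 2 * Qf ((a + b) / 2) ≤ Qf a + Qf b := by
  wlog h : a ≤ b generalizing a b
  · have := this hb ha (by linarith)
    rw [add_comm b a] at this; linarith
  have h1 := Qf_sub_ge (u := a) (w := (a + b) / 2) ha (by linarith)
  have h2 := Qf_sub_le (u := (a + b) / 2) (w := b) (by linarith) (by linarith)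
  nlinarith

lemma Qf_lt {d : ℝ} (hd : 0 < d) : 0 < 1 - 2 * Qf d := by
  have h1 := Qf_sub_ge (u := 0) (w := d) le_rfl hd.le
  rw [Qf_zero] at h1
  have := mul_pos hd (ph_pos d)
  linarith

lemma Qf_ge {d : ℝ} (hd : 0 < d) : 1 - 2 * Qf d ≤ 2 * d / Real.sqrt (2 * π) := by
  have h1 := Qf_sub_le (u := 0) (w := d) le_rfl hd.le
  rw [Qf_zero, ph_zero] at h1
  have : 2 * d / Real.sqrt (2 * π) = 2 * ((d - 0) * (1 / Real.sqrt (2 * π))) := by ring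
  linarith

lemma gam_integral (s : Set ℝ) (hs : MeasurableSet s) (F : ℝ → ℝ) :
    ∫ t in s, F t ∂gam = ∫ t in s, ph t * F t := by
  rw [← integral_indicator hs, ← integral_indicator hs,
    integral_gaussianReal_eq_integral_smul one_ne_zero, ← ph_eq]
  congr 1; ext t
  by_cases h : t ∈ s <;> simp [h]

lemma gam_Ioi (ξ : ℝ) : gam.real (Ioi ξ) = Qf ξ := by
  have := gam_integral (Ioi ξ) measurableSet_Ioi (fun _ => 1)
  simpa [Qf_eq] using this

lemma gam_neg : gam.map (fun x => -x) = gam := by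
  simp [gam, gaussianReal_map_neg]

lemma gam_Iio (ξ : ℝ) : gam.real (Iio (-ξ)) = Qf ξ := by
  rw [← gam_Ioi]
  conv_lhs => rw [← gam_neg]
  rw [map_measureReal_apply (by fun_prop) measurableSet_Iio]
  congr 1; ext; simp

lemma gam_sq_integrable : Integrable (fun t : ℝ => t ^ 2) gam := by
  have := (memLp_id_gaussianReal (μ := 0) (v := 1) 2)
  exact this.integrable_sq

lemma gam_integrable_iff (F : ℝ → ℝ) : Integrable F gam ↔ Integrable (fun t => ph t * F t) := by
  rw [gam, gaussianReal_of_var_ne_zero _ one_ne_zero, integrable_withDensity_iff_integrable_smul'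
    (measurable_gaussianPDF _ _) (ae_of_all _ fun _ => gaussianPDF_lt_top)]
  simp [toReal_gaussianPDF, ph_eq]

lemma gam_sq_add_integrable (c : ℝ) : Integrable (fun t : ℝ => (t + c) ^ 2) gam := by
  have := (memLp_id_gaussianReal (μ := 0) (v := 1) 2)
  exact (this.add (memLp_const c)).integrable_sq

lemma gam_sq : ∫ t, t ^ 2 ∂gam = 1 := by
  have := variance_fun_id_gaussianReal (μ := 0) (v := 1)
  rw [variance_eq_integral measurable_id'.aemeasurable] at this
  simpa using this

lemma gam_tail (d : ℝ) : ∫ t in Ioi d, t ^ 2 ∂gam = Qf d + d * ph d := by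
  rw [gam_integral _ measurableSet_Ioi]
  have hi := ((gam_integrable_iff _).1 gam_sq_integrable)
  have key : ∫ t in Ioi d, (ph t * t ^ 2 - ph t) = 0 - (-(d * ph d)) := by
    refine integral_Ioi_of_hasDerivAt_of_tendsto' (f := fun t => -(t * ph t)) ?_ ?_ ?_
    · intro x _
      have h1 : HasDerivAt ph (ph x * (-x)) x := by
        have h0 : HasDerivAt (fun t : ℝ => -t ^ 2 / 2) (-x) x := by
          have := ((hasDerivAt_pow 2 x).neg).div_const 2
          refine this.congr_deriv ?_
          simp
          ring
        have := (h0.exp).const_mul (1 / Real.sqrt (2 * π))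
        refine this.congr_deriv ?_
        simp only [ph]; ring
      have := ((hasDerivAt_id x).mul h1).neg
      refine this.congr_deriv ?_
      simp; ring
    · exact (hi.sub ph_integrable).integrableOn
    · have h := (tendsto_rpow_abs_mul_exp_neg_mul_sq_cocompact (a := 1/2) (by norm_num) 1).mono_left atTop_le_cocompact
      have h2 := (h.const_mul (-(1 / Real.sqrt (2 * π))))
      rw [mul_zero] at h2
      refine h2.congr' ?_
      filter_upwards [eventually_ge_atTop 0] with t ht
      rw [abs_of_nonneg ht, rpow_one]
      unfold ph
      rw [show -(1/2) * t^2 = -t^2/2 by ring]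
      ring
  rw [integral_sub hi.integrableOn ph_integrable.integrableOn, ← Qf_eq] at key
  linarith

lemma gam_tail_shift {d ξ : ℝ} (hd : 0 ≤ d) (hξ : 0 ≤ ξ) :
    ∫ t in Ioi (ξ + d), (t - ξ) ^ 2 ∂gam ≤ Qf d + d * ph d := by
  rw [← gam_tail, gam_integral _ measurableSet_Ioi, gam_integral _ measurableSet_Ioi]
  have hi := ((gam_integrable_iff _).1 gam_sq_integrable)
  have hi2 := ((gam_integrable_iff _).1 (gam_sq_add_integrable (-ξ)))
  have e : ∫ t in Ioi (ξ + d), ph t * (t - ξ) ^ 2 = ∫ t in Ioi d, ph (t + ξ) * t ^ 2 := by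
    have hm : MeasurePreserving (fun t : ℝ => t + ξ) := measurePreserving_add_right volume ξ
    have := hm.setIntegral_preimage_emb (measurableEmbedding_addRight ξ) (fun t => ph t * (t - ξ) ^ 2) (Ioi (ξ + d))
    rw [← this]
    simp [add_comm ξ d]
  rw [e]
  refine setIntegral_mono_on ?_ hi.integrableOn measurableSet_Ioi ?_
  · have := hi2.comp_add_right ξ
    simp only [add_neg_cancel_right] at this
    exact this.integrableOn
  · intro t ht
    have : 0 ≤ t := hd.trans (le_of_lt ht)
    have := ph_anti this (t := t + ξ) (by linarith)
    gcongr

lemma gam_tail_shift' {d ξ : ℝ} (hd : 0 ≤ d) (hξ : 0 ≤ ξ) :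
    ∫ t in Iio (-(ξ + d)), (t + ξ) ^ 2 ∂gam ≤ Qf d + d * ph d := by
  refine le_trans (le_of_eq ?_) (gam_tail_shift hd hξ)
  have hm : MeasurePreserving (fun t : ℝ => -t) gam gam := ⟨by fun_prop, gam_neg⟩
  have := hm.setIntegral_preimage_emb (MeasurableEquiv.neg ℝ).measurableEmbedding (fun t => (t + ξ) ^ 2) (Iio (-(ξ + d)))
  rw [← this]
  have e : (fun t : ℝ => -t) ⁻¹' (Iio (-(ξ + d))) = Ioi (ξ + d) := by ext; simp
  rw [e]
  congr 1; ext t; ring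

noncomputable def kk (L ξ η d t : ℝ) : ℝ :=
  -t ^ 2 / 2 + L + (Iio (-(ξ + d))).indicator (fun t => (t + ξ) ^ 2 / 2 - L) t
    + (Ioi (η + d)).indicator (fun t => (t - η) ^ 2 / 2 - L) t

lemma inner_bound {L ξ η d : ℝ} (hL : 0 ≤ L) (hξ : 0 ≤ ξ) (hη : 0 ≤ η) (hd : 0 ≤ d) :
    ∫ t, kk L ξ η d t ∂gam ≤
      (1 - 2 * Qf (d + (ξ + η) / 2)) * L - 1 / 2 + Qf d + d * ph d := by
  have i0 : Integrable (fun t : ℝ => -t ^ 2 / 2) gam := gam_sq_integrable.neg.div_const 2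
  have i1 : Integrable (fun _ : ℝ => L) gam := integrable_const _
  have j2 : Integrable (fun t : ℝ => (t + ξ) ^ 2 / 2) gam :=
    ((gam_sq_add_integrable ξ).div_const 2)
  have j3 : Integrable (fun t : ℝ => (t - η) ^ 2 / 2) gam :=
    ((gam_sq_add_integrable (-η)).div_const 2)
  have i2 : Integrable ((Iio (-(ξ + d))).indicator (fun t => (t + ξ) ^ 2 / 2 - L)) gam :=
    (j2.sub i1).indicator measurableSet_Iio
  have i3 : Integrable ((Ioi (η + d)).indicator (fun t => (t - η) ^ 2 / 2 - L)) gam :=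
    (j3.sub i1).indicator measurableSet_Ioi
  unfold kk
  rw [integral_add (by exact (i0.add i1).add i2) i3, integral_add (by exact i0.add i1) i2, integral_add i0 i1,
    integral_indicator measurableSet_Iio, integral_indicator measurableSet_Ioi,
    integral_sub j2.integrableOn i1.integrableOn, integral_sub j3.integrableOn i1.integrableOn]
  simp only [integral_div, integral_neg, gam_sq, gam_Iio, gam_Ioi, smul_eq_mul,
    integral_const, probReal_univ, one_mul, measureReal_restrict_apply MeasurableSet.univ, univ_inter]
  have h1 := gam_tail_shift hd hη
  have h2 := gam_tail_shift' hd hξ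
  have h3 := Qf_mid (a := ξ + d) (b := η + d) (by linarith) (by linarith)
  rw [show (ξ + d + (η + d)) / 2 = d + (ξ + η) / 2 by ring] at h3
  have := mul_le_mul_of_nonneg_right h3 hL
  linarith

noncomputable def vv (σ : ℝ) : NNReal := NNReal.mk (σ ^ 2) (sq_nonneg σ)

lemma vv_coe (σ : ℝ) : ((vv σ : NNReal) : ℝ) = σ ^ 2 := rfl

noncomputable def Gd (σ x y : ℝ) : ℝ := σ⁻¹ * ph ((y - x) / σ)

lemma Gd_pos {σ : ℝ} (hσ : 0 < σ) (x y : ℝ) : 0 < Gd σ x y :=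
  mul_pos (inv_pos.2 hσ) (ph_pos _)

lemma Gd_meas (σ : ℝ) : Measurable (fun p : ℝ × ℝ => Gd σ p.1 p.2) := by
  unfold Gd
  exact (ph_continuous.measurable.comp (by fun_prop)).const_mul _

noncomputable def GE (σ x y : ℝ) : ENNReal := ENNReal.ofReal (Gd σ x y)

lemma GE_meas (σ : ℝ) : Measurable (fun p : ℝ × ℝ => GE σ p.1 p.2) :=
  (Gd_meas σ).ennreal_ofReal

lemma GE_meas' (σ x : ℝ) : Measurable (GE σ x) :=
  (GE_meas σ).comp (g := fun p : ℝ × ℝ => GE σ p.1 p.2) (f := fun y : ℝ => (x, y)) (by fun_prop)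

lemma GE_eq {σ : ℝ} (hσ : 0 < σ) (x : ℝ) : GE σ x = gaussianPDF x (vv σ) := by
  ext y
  unfold GE Gd gaussianPDF gaussianPDFReal ph
  congr 1
  have h1 : √(2 * π * σ ^ 2) = √(2 * π) * σ := by
    rw [Real.sqrt_mul (by positivity), Real.sqrt_sq hσ.le]
  rw [vv_coe, h1]
  rw [show -((y - x) / σ) ^ 2 / 2 = -(y - x) ^ 2 / (2 * σ ^ 2) by field_simp]
  field_simp

lemma vne {σ : ℝ} (hσ : 0 < σ) : vv σ ≠ 0 := by
  intro h
  have := congrArg NNReal.toReal h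
  rw [vv_coe] at this
  simp at this
  exact hσ.ne' this

lemma gauss_wd {σ : ℝ} (hσ : 0 < σ) (x : ℝ) :
    gaussianReal x (vv σ) = volume.withDensity (GE σ x) := by
  rw [gaussianReal_of_var_ne_zero _ (vne hσ), GE_eq hσ]

lemma gauss_map (σ x : ℝ) :
    gam.map (fun t => x + σ * t) = gaussianReal x (vv σ) := by
  have h1 := gaussianReal_map_const_mul (μ := 0) (v := 1) σ
  have h2 := gaussianReal_map_const_add (μ := 0) (v := (vv σ)) x
  rw [mul_one, mul_zero] at h1
  change _ = gaussianReal 0 (vv σ) at h1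
  rw [zero_add] at h2
  rw [← h2, ← h1, Measure.map_map (by fun_prop) (by fun_prop)]
  rfl

lemma joint_eq (σ : ℝ) (Q : Measure ℝ) [IsProbabilityMeasure Q] :
    jointLaw σ Q = (Q.prod gam).map (fun p => (p.1, p.1 + σ * p.2)) := by
  change (Q.prod (gaussianReal 0 (vv σ))).map (fun p => (p.1, p.1 + p.2)) = _
  have h1 : gaussianReal 0 (vv σ) = gam.map (fun t => σ * t) := by
    rw [← gauss_map]; simp
  have h2 : Q.prod (gam.map (fun t => σ * t)) = (Q.prod gam).map (Prod.map id (fun t => σ * t)) := by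
    rw [← Measure.map_prod_map _ _ measurable_id (by fun_prop), Measure.map_id]
  rw [h1, h2, Measure.map_map (by fun_prop) (by fun_prop)]
  rfl

lemma joint_wd {σ : ℝ} (hσ : 0 < σ) (Q : Measure ℝ) [IsProbabilityMeasure Q] :
    jointLaw σ Q = (Q.prod volume).withDensity (fun p => GE σ p.1 p.2) := by
  refine Measure.ext_of_lintegral _ fun F hF => ?_
  rw [joint_eq, lintegral_map hF (by fun_prop), lintegral_prod _ (by fun_prop),
    lintegral_withDensity_eq_lintegral_mul _ (GE_meas σ) hF,
    lintegral_prod _ ((GE_meas σ).mul hF).aemeasurable]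
  refine lintegral_congr fun x => ?_
  have hFx : Measurable (fun y => F (x, y)) := by fun_prop
  have := lintegral_map (μ := gam) hFx (g := fun t => x + σ * t) (by fun_prop)
  rw [← this, gauss_map, gauss_wd hσ, lintegral_withDensity_eq_lintegral_mul _ (GE_meas' σ x) hFx]
  rfl

noncomputable def fE (σ : ℝ) (Q : Measure ℝ) (y : ℝ) : ENNReal := ∫⁻ x, GE σ x y ∂Q

lemma fE_meas (σ : ℝ) (Q : Measure ℝ) [IsProbabilityMeasure Q] : Measurable (fE σ Q) :=
  (GE_meas σ).lintegral_prod_left'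

lemma joint_fst (σ : ℝ) (Q : Measure ℝ) [IsProbabilityMeasure Q] :
    (jointLaw σ Q).map Prod.fst = Q := by
  rw [joint_eq, Measure.map_map (by fun_prop) (by fun_prop)]
  have : (Prod.fst ∘ fun p : ℝ × ℝ => (p.1, p.1 + σ * p.2)) = Prod.fst := rfl
  rw [this, Measure.map_fst_prod]
  simp

lemma joint_snd {σ : ℝ} (hσ : 0 < σ) (Q : Measure ℝ) [IsProbabilityMeasure Q] :
    (jointLaw σ Q).map Prod.snd = volume.withDensity (fE σ Q) := by
  refine Measure.ext_of_lintegral _ fun F hF => ?_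
  have hF2 : Measurable (fun p : ℝ × ℝ => F p.2) := by fun_prop
  rw [lintegral_map hF (by fun_prop), joint_wd hσ,
    lintegral_withDensity_eq_lintegral_mul _ (GE_meas σ) hF2,
    lintegral_withDensity_eq_lintegral_mul _ (fE_meas σ Q) hF,
    lintegral_prod_symm' _ ((GE_meas σ).mul hF2)]
  refine lintegral_congr fun y => ?_
  simp only [Pi.mul_apply, fE]
  rw [lintegral_mul_const]
  exact (GE_meas σ).comp (g := fun p : ℝ × ℝ => GE σ p.1 p.2) (f := fun x : ℝ => (x, y)) (by fun_prop)

lemma fE_le {σ : ℝ} (hσ : 0 < σ) (Q : Measure ℝ) [IsProbabilityMeasure Q] (y : ℝ) :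
    fE σ Q y ≤ ENNReal.ofReal (σ⁻¹ * ph 0) := by
  have : fE σ Q y ≤ ∫⁻ x, ENNReal.ofReal (σ⁻¹ * ph 0) ∂Q := by
    refine lintegral_mono fun x => ENNReal.ofReal_le_ofReal ?_
    unfold Gd
    gcongr
    have : ph ((y - x) / σ) = ph |(y - x) / σ| := by simp [ph]
    rw [this]
    exact ph_anti le_rfl (abs_nonneg _)
  simpa using this

lemma Q_ae {A : ℝ} (Q : Measure ℝ) [IsProbabilityMeasure Q] (hQ : Q (Icc 0 A) = 1) :
    ∀ᵐ x ∂Q, x ∈ Icc 0 A :=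
  (prob_compl_eq_zero_iff measurableSet_Icc).2 hQ

lemma le_fE {σ A : ℝ} (hσ : 0 < σ) (Q : Measure ℝ) [IsProbabilityMeasure Q]
    (hQ : Q (Icc 0 A) = 1) (y : ℝ) :
    ENNReal.ofReal (σ⁻¹ * ph ((|y| + A) / σ)) ≤ fE σ Q y := by
  have : ∫⁻ x, ENNReal.ofReal (σ⁻¹ * ph ((|y| + A) / σ)) ∂Q ≤ fE σ Q y := by
    refine lintegral_mono_ae ?_
    filter_upwards [Q_ae Q hQ] with x hx
    refine ENNReal.ofReal_le_ofReal ?_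
    unfold Gd
    gcongr
    have : ph ((y - x) / σ) = ph |(y - x) / σ| := by simp [ph]
    rw [this]
    refine ph_anti (abs_nonneg _) ?_
    rw [abs_div, abs_of_pos hσ]
    gcongr
    refine (abs_sub _ _).trans ?_
    rw [abs_of_nonneg hx.1]
    linarith [hx.2]
  simpa using this

noncomputable def fr (σ : ℝ) (Q : Measure ℝ) (y : ℝ) : ℝ := (fE σ Q y).toReal

section
variable {σ A : ℝ} (hσ : 0 < σ) (Q : Measure ℝ) [IsProbabilityMeasure Q] (hQ : Q (Icc 0 A) = 1)

lemma fE_ne_top (hσ : 0 < σ) (y : ℝ) : fE σ Q y ≠ ⊤ :=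
  ne_top_of_le_ne_top ENNReal.ofReal_ne_top (fE_le hσ Q y)

lemma fE_ne_zero (hσ : 0 < σ) (hQ : Q (Icc 0 A) = 1) (y : ℝ) : fE σ Q y ≠ 0 := by
  have := le_fE hσ Q hQ y
  have h2 : 0 < ENNReal.ofReal (σ⁻¹ * ph ((|y| + A) / σ)) := by
    have := ph_pos ((|y| + A) / σ)
    rw [ENNReal.ofReal_pos]; positivity
  exact (h2.trans_le this).ne'

lemma fr_le (hσ : 0 < σ) (y : ℝ) : fr σ Q y ≤ σ⁻¹ * ph 0 := by
  have := ph_pos 0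
  exact ENNReal.toReal_le_of_le_ofReal (by positivity) (fE_le hσ Q y)

lemma le_fr (hσ : 0 < σ) (hQ : Q (Icc 0 A) = 1) (y : ℝ) :
    σ⁻¹ * ph ((|y| + A) / σ) ≤ fr σ Q y :=
  (ENNReal.ofReal_le_iff_le_toReal (fE_ne_top Q hσ y)).1 (le_fE hσ Q hQ y)

lemma fr_pos (hσ : 0 < σ) (hQ : Q (Icc 0 A) = 1) (y : ℝ) : 0 < fr σ Q y :=
  ENNReal.toReal_pos (fE_ne_zero Q hσ hQ y) (fE_ne_top Q hσ y)

lemma log_ph (t : ℝ) : Real.log (ph t) = -Real.log (Real.sqrt (2 * π)) - t ^ 2 / 2 := by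
  unfold ph
  rw [Real.log_mul (by positivity) (by positivity), Real.log_exp, one_div, Real.log_inv]
  ring

lemma log_sph (hσ : 0 < σ) (t : ℝ) :
    Real.log (σ⁻¹ * ph t) = -Real.log σ - Real.log (Real.sqrt (2 * π)) - t ^ 2 / 2 := by
  rw [Real.log_mul (by positivity) (ph_pos t).ne', log_ph, Real.log_inv]
  ring

noncomputable def psi (σ : ℝ) (Q : Measure ℝ) (p : ℝ × ℝ) : ℝ :=
  Real.log (Gd σ p.1 p.2) - Real.log (fr σ Q p.2)

lemma psi_meas : Measurable (psi σ Q) := by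
  unfold psi
  have h1 := Gd_meas σ
  have h2 : Measurable (fr σ Q) := (fE_meas σ Q).ennreal_toReal
  fun_prop

lemma joint_prod (hσ : 0 < σ) (hQ : Q (Icc 0 A) = 1) :
    jointLaw σ Q = (Q.prod (volume.withDensity (fE σ Q))).withDensity
      (fun p => GE σ p.1 p.2 / fE σ Q p.2) := by
  have hm := fE_meas σ Q
  have hm2 : Measurable (fun p : ℝ × ℝ => fE σ Q p.2) := by fun_prop
  rw [prod_withDensity_right hm]
  rw [← withDensity_mul _ hm2 ((GE_meas σ).fun_div hm2), joint_wd hσ]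
  congr 1
  ext p
  simp only [Pi.mul_apply]
  rw [ENNReal.mul_div_cancel (fE_ne_zero Q hσ hQ _) (fE_ne_top Q hσ _)]

lemma sf (hσ : 0 < σ) : IsProbabilityMeasure (volume.withDensity (fE σ Q)) := by
  rw [← joint_snd hσ, joint_eq, Measure.map_map (by fun_prop) (by fun_prop)]
  exact Measure.isProbabilityMeasure_map (by fun_prop)

lemma llr_ae (hσ : 0 < σ) (hQ : Q (Icc 0 A) = 1) :
    llr (jointLaw σ Q) (Q.prod (volume.withDensity (fE σ Q))) =ᵐ[jointLaw σ Q] psi σ Q := by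
  have := sf Q hσ
  have hm2 : Measurable (fun p : ℝ × ℝ => fE σ Q p.2) := (fE_meas σ Q).comp measurable_snd
  have h := Measure.rnDeriv_withDensity (Q.prod (volume.withDensity (fE σ Q)))
    ((GE_meas σ).fun_div hm2)
  have hac : jointLaw σ Q ≪ Q.prod (volume.withDensity (fE σ Q)) := by
    rw [joint_prod Q hσ hQ]; exact withDensity_absolutelyContinuous _ _
  refine hac.ae_le ?_
  have hj := joint_prod Q hσ hQ
  filter_upwards [h] with p hp
  unfold llr psi
  rw [hj, hp, ENNReal.toReal_div, Real.log_div]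
  · congr 2
    exact ENNReal.toReal_ofReal (Gd_pos hσ _ _).le
  · rw [GE, ENNReal.toReal_ofReal (Gd_pos hσ _ _).le]
    exact (Gd_pos hσ _ _).ne'
  · exact (fr_pos Q hσ hQ _).ne'

lemma snd_sq_int : Integrable (fun p : ℝ × ℝ => p.2 ^ 2) (Q.prod gam) :=
  gam_sq_integrable.comp_snd Q

lemma prod_ae (hQ : Q (Icc 0 A) = 1) : ∀ᵐ p ∂(Q.prod gam), p.1 ∈ Icc 0 A :=
  Measure.quasiMeasurePreserving_fst.ae (Q_ae Q hQ)

lemma psi_int (hσ : 0 < σ) (hQ : Q (Icc 0 A) = 1) :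
    Integrable (fun p : ℝ × ℝ => psi σ Q (p.1, p.1 + σ * p.2)) (Q.prod gam) := by
  have hb : Integrable (fun p : ℝ × ℝ => (2 * A / σ) ^ 2 + 2 * p.2 ^ 2) (Q.prod gam) :=
    (integrable_const _).add ((snd_sq_int Q).const_mul 2)
  refine hb.mono' ((psi_meas Q).comp (by fun_prop)).aestronglyMeasurable ?_
  filter_upwards [prod_ae Q hQ] with p hp
  obtain ⟨x, t⟩ := p
  simp only at hp ⊢
  have h1 := Real.log_le_log (fr_pos Q hσ hQ (x + σ * t)) (fr_le Q hσ (x + σ * t))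
  have h2 := Real.log_le_log (mul_pos (inv_pos.2 hσ) (ph_pos _)) (le_fr Q hσ hQ (x + σ * t))
  rw [log_sph hσ] at h1 h2
  unfold psi
  simp only [Gd]
  rw [log_sph hσ]
  have e : (x + σ * t - x) / σ = t := by field_simp; ring
  rw [e]
  have h3 : ((|x + σ * t| + A) / σ) ^ 2 ≤ (2 * A / σ + |t|) ^ 2 := by
    have hA : 0 ≤ A := hp.1.trans hp.2
    have : (|x + σ * t| + A) / σ ≤ 2 * A / σ + |t| := by
      rw [div_add' _ _ _ hσ.ne']
      refine div_le_div_of_nonneg_right ?_ hσ.le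
      have := abs_add_le x (σ * t)
      rw [abs_of_nonneg hp.1, abs_mul, abs_of_pos hσ] at this
      have h9 : 2 * A / σ * σ = 2 * A := by field_simp
      nlinarith [hp.2]
    gcongr
  have h4 := sq_nonneg (2 * A / σ - |t|)
  have h5 := sq_abs t
  have h6 := sq_nonneg t
  have h7 := sq_nonneg (2 * A / σ)
  rw [Real.norm_eq_abs, abs_le]
  constructor <;> nlinarith

end

noncomputable def rr (σ A δ c y : ℝ) : ℝ :=
  if y < -δ then Gd σ 0 y else if y ≤ A + δ then c else Gd σ A y

lemma gauss_Iio {σ : ℝ} (hσ : 0 < σ) (δ : ℝ) :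
    ∫⁻ y in Iio (-δ), GE σ 0 y = ENNReal.ofReal (Qf (δ / σ)) := by
  rw [← withDensity_apply _ measurableSet_Iio, ← gauss_wd hσ, ← gauss_map,
    Measure.map_apply (by fun_prop) measurableSet_Iio, ← gam_Iio, ofReal_measureReal]
  congr 1
  ext t
  simp only [mem_preimage, mem_Iio, zero_add]
  rw [← neg_div, lt_div_iff₀ hσ, mul_comm]

lemma gauss_Ioi {σ : ℝ} (hσ : 0 < σ) (A δ : ℝ) :
    ∫⁻ y in Ioi (A + δ), GE σ A y = ENNReal.ofReal (Qf (δ / σ)) := by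
  rw [← withDensity_apply _ measurableSet_Ioi, ← gauss_wd hσ, ← gauss_map,
    Measure.map_apply (by fun_prop) measurableSet_Ioi, ← gam_Ioi, ofReal_measureReal]
  congr 1
  ext t
  simp only [mem_preimage, mem_Ioi]
  rw [div_lt_iff₀ hσ, mul_comm t]
  constructor <;> intro h <;> linarith

lemma Qf_nonneg (ξ : ℝ) : 0 ≤ Qf ξ := by
  rw [← gam_Ioi]; exact measureReal_nonneg

lemma rr_lint {σ A δ : ℝ} (hσ : 0 < σ) (hA : 0 < A) (hδ : 0 < δ) :
    ∫⁻ y, ENNReal.ofReal (rr σ A δ ((1 - 2 * Qf (δ / σ)) / (A + 2 * δ)) y) ≤ 1 := by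
  set c := (1 - 2 * Qf (δ / σ)) / (A + 2 * δ) with hc
  have hq := Qf_lt (div_pos hδ hσ)
  have hc0 : 0 < c := by positivity
  have e : ∀ y, ENNReal.ofReal (rr σ A δ c y) = (Iio (-δ)).indicator (GE σ 0) y
      + ((Icc (-δ) (A + δ)).indicator (fun _ => ENNReal.ofReal c) y
      + (Ioi (A + δ)).indicator (GE σ A) y) := by
    intro y
    unfold rr
    by_cases h1 : y < -δ
    · have h2 : ¬ (A + δ < y) := by linarith
      simp [h1, h2, GE]
    · by_cases h2 : y ≤ A + δ
      · simp [h1, h2, not_lt.2 h2, not_lt.1 h1]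
      · simp [h1, h2, not_le.1 h2, GE]
  simp_rw [e]
  rw [lintegral_add_left ((GE_meas' σ 0).indicator measurableSet_Iio),
    lintegral_add_left (measurable_const.indicator measurableSet_Icc),
    lintegral_indicator measurableSet_Iio, lintegral_indicator measurableSet_Icc,
    lintegral_indicator measurableSet_Ioi, gauss_Iio hσ, gauss_Ioi hσ, setLIntegral_const,
    Real.volume_Icc, ← ENNReal.ofReal_mul hc0.le, ← ENNReal.ofReal_add (by apply mul_nonneg hc0.le; linarith) (Qf_nonneg _),
    ← ENNReal.ofReal_add (Qf_nonneg _) (add_nonneg (by apply mul_nonneg hc0.le; linarith) (Qf_nonneg _)),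
    ENNReal.ofReal_le_one]
  have : c * (A + δ - -δ) = 1 - 2 * Qf (δ / σ) := by
    rw [hc]; field_simp; ring
  rw [this]; linarith

lemma rr_pos {σ A δ c : ℝ} (hσ : 0 < σ) (hc : 0 < c) (y : ℝ) : 0 < rr σ A δ c y := by
  unfold rr
  split_ifs
  · exact Gd_pos hσ _ _
  · exact hc
  · exact Gd_pos hσ _ _

lemma rr_meas (σ A δ c : ℝ) : Measurable (rr σ A δ c) := by
  have h (x : ℝ) : Measurable (Gd σ x) := by
    unfold Gd
    exact (ph_continuous.measurable.comp (by fun_prop)).const_mul _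
  exact Measurable.ite measurableSet_Iio (h 0) (Measurable.ite measurableSet_Iic measurable_const (h A))

lemma log_ratio {σ A δ c x t : ℝ} (hσ : 0 < σ) (hδ : 0 < δ) (hc : 0 < c) (hx : x ∈ Icc 0 A) :
    Real.log (Gd σ x (x + σ * t)) - Real.log (rr σ A δ c (x + σ * t)) =
      kk (-Real.log σ - Real.log (Real.sqrt (2 * π)) - Real.log c)
        (x / σ) ((A - x) / σ) (δ / σ) t := by
  have e : (x + σ * t - x) / σ = t := by field_simp; ring
  have c1 : x + σ * t < -δ ↔ t < -(x / σ + δ / σ) := by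
    rw [← add_div, ← neg_div, lt_div_iff₀ hσ]
    constructor <;> intro h <;> linarith
  have c2 : x + σ * t ≤ A + δ ↔ ¬ ((A - x) / σ + δ / σ < t) := by
    rw [← add_div, div_lt_iff₀ hσ, not_lt]
    constructor <;> intro h <;> linarith
  have hx1 : 0 ≤ x / σ := div_nonneg hx.1 hσ.le
  have hx2 : 0 ≤ (A - x) / σ := div_nonneg (by linarith [hx.2]) hσ.le
  have hd : 0 < δ / σ := div_pos hδ hσ
  unfold kk rr
  simp only [indicator, mem_Iio, mem_Ioi, Gd]
  rw [log_sph hσ, e]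
  by_cases h1 : t < -(x / σ + δ / σ)
  · have h2 : ¬ ((A - x) / σ + δ / σ < t) := by linarith
    rw [if_pos (c1.2 h1), if_pos h1, if_neg h2, log_sph hσ]
    have : (x + σ * t - 0) / σ = t + x / σ := by field_simp; ring
    rw [this]; ring
  · rw [if_neg (by rwa [c1]), if_neg h1]
    by_cases h2 : (A - x) / σ + δ / σ < t
    · rw [if_neg (by rw [c2]; simpa using h2), if_pos h2, log_sph hσ]
      have : (x + σ * t - A) / σ = t - (A - x) / σ := by field_simp; ring
      rw [this]; ring
    · rw [if_pos (by rwa [c2]), if_neg h2]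
      ring

lemma kk_int {σ A δ L : ℝ} (hσ : 0 < σ) (hδ : 0 < δ) (hL : 0 ≤ L) (Q : Measure ℝ)
    [IsProbabilityMeasure Q] (hQ : Q (Icc 0 A) = 1) :
    Integrable (fun p : ℝ × ℝ => kk L (p.1 / σ) ((A - p.1) / σ) (δ / σ) p.2) (Q.prod gam) := by
  have hb : Integrable (fun p : ℝ × ℝ => 3 * L + 2 * p.2 ^ 2) (Q.prod gam) :=
    (integrable_const _).add ((snd_sq_int Q).const_mul 2)
  refine hb.mono' ?_ ?_
  · unfold kk
    simp only [indicator, mem_Iio, mem_Ioi]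
    refine Measurable.aestronglyMeasurable ?_
    refine (Measurable.add (by fun_prop) ?_).add ?_
    · exact Measurable.ite (measurableSet_lt (by fun_prop) (by fun_prop)) (by fun_prop) (by fun_prop)
    · exact Measurable.ite (measurableSet_lt (by fun_prop) (by fun_prop)) (by fun_prop) (by fun_prop)
  · filter_upwards [prod_ae Q hQ] with p hp
    obtain ⟨x, t⟩ := p
    simp only at hp ⊢
    have hx1 : 0 ≤ x / σ := div_nonneg hp.1 hσ.le
    have hx2 : 0 ≤ (A - x) / σ := div_nonneg (by linarith [hp.2]) hσ.le
    have hd : 0 < δ / σ := div_pos hδ hσ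
    have a1 : |(Iio (-(x / σ + δ / σ))).indicator (fun t => (t + x / σ) ^ 2 / 2 - L) t|
        ≤ t ^ 2 / 2 + L := by
      by_cases h : t < -(x / σ + δ / σ)
      · rw [indicator_of_mem (by exact h), abs_le]
        constructor <;> nlinarith [sq_nonneg t, sq_nonneg (t + x / σ)]
      · rw [indicator_of_notMem (by exact h)]; simp; positivity
    have a2 : |(Ioi ((A - x) / σ + δ / σ)).indicator (fun t => (t - (A - x) / σ) ^ 2 / 2 - L) t|
        ≤ t ^ 2 / 2 + L := by
      by_cases h : (A - x) / σ + δ / σ < t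
      · rw [indicator_of_mem (by exact h), abs_le]
        constructor <;> nlinarith [sq_nonneg t, sq_nonneg (t - (A - x) / σ)]
      · rw [indicator_of_notMem (by exact h)]; simp; positivity
    unfold kk
    rw [abs_le] at a1 a2
    rw [Real.norm_eq_abs, abs_le]
    constructor <;> linarith [sq_nonneg t, a1.1, a1.2, a2.1, a2.2]

lemma main_bound {σ A δ : ℝ} (hσ : 0 < σ) (hA : 0 < A) (hδ : 0 < δ) (Q : Measure ℝ)
    [IsProbabilityMeasure Q] (hQ : Q (Icc 0 A) = 1) :
    ∫ p, psi σ Q p ∂(jointLaw σ Q) ≤ (1 - 2 * Qf ((δ + A / 2) / σ)) *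
          Real.log ((A + 2 * δ) / (σ * Real.sqrt (2 * π) * (1 - 2 * Qf (δ / σ))))
        - 1 / 2 + Qf (δ / σ) + δ / σ * ph (δ / σ) := by
  set c := (1 - 2 * Qf (δ / σ)) / (A + 2 * δ) with hc
  have hq := Qf_lt (div_pos hδ hσ)
  have hc0 : 0 < c := by positivity
  have h2π : 0 < Real.sqrt (2 * π) := by positivity
  set L := Real.log ((A + 2 * δ) / (σ * Real.sqrt (2 * π) * (1 - 2 * Qf (δ / σ)))) with hLdef
  have hLe : -Real.log σ - Real.log (Real.sqrt (2 * π)) - Real.log c = L := by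
    rw [hLdef, hc, Real.log_div (by positivity) (by positivity), Real.log_div (by positivity) (by positivity),
      Real.log_mul (by positivity) (by positivity), Real.log_mul (by positivity) (by positivity)]
    ring
  have hL : 0 ≤ L := by
    apply Real.log_nonneg
    rw [le_div_iff₀ (by positivity), one_mul]
    have h := Qf_ge (div_pos hδ hσ)
    rw [le_div_iff₀ h2π] at h
    have h' := mul_le_mul_of_nonneg_right h hσ.le
    have : 2 * (δ / σ) * σ = 2 * δ := by field_simp
    nlinarith
  set B := (1 - 2 * Qf ((δ + A / 2) / σ)) * L - 1 / 2 + Qf (δ / σ) + δ / σ * ph (δ / σ) with hB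
  have hT : Measurable (fun p : ℝ × ℝ => (p.1, p.1 + σ * p.2)) := by fun_prop
  have hfm : Measurable (fr σ Q) := (fE_meas σ Q).ennreal_toReal
  have hrm := rr_meas σ A δ c
  have hρ0 (y : ℝ) : 0 ≤ rr σ A δ c y / fr σ Q y :=
    (div_pos (rr_pos hσ hc0 y) (fr_pos Q hσ hQ y)).le

  have hlint : ∫⁻ p, ENNReal.ofReal (rr σ A δ c (p.1 + σ * p.2) / fr σ Q (p.1 + σ * p.2)) ∂(Q.prod gam) ≤ 1 := by
    have hm : Measurable (fun y => ENNReal.ofReal (rr σ A δ c y / fr σ Q y)) :=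
      (hrm.div hfm).ennreal_ofReal
    have e1 := lintegral_map (μ := Q.prod gam) (f := fun p : ℝ × ℝ => ENNReal.ofReal (rr σ A δ c p.2 / fr σ Q p.2))
      (hm.comp measurable_snd) hT
    simp only at e1
    rw [← e1, ← joint_eq]
    have e2 := lintegral_map (μ := jointLaw σ Q) hm measurable_snd
    rw [← e2, joint_snd hσ, lintegral_withDensity_eq_lintegral_mul _ (fE_meas σ Q) hm]
    refine le_trans (le_of_eq ?_) (rr_lint hσ hA hδ)
    refine lintegral_congr fun y => ?_
    have hf : fE σ Q y = ENNReal.ofReal (fr σ Q y) := (ENNReal.ofReal_toReal (fE_ne_top Q hσ y)).symm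
    rw [Pi.mul_apply, hf, ← ENNReal.ofReal_mul (fr_pos Q hσ hQ y).le,
      mul_div_cancel₀ _ (fr_pos Q hσ hQ y).ne']
  have hρm : AEStronglyMeasurable (fun p : ℝ × ℝ => rr σ A δ c (p.1 + σ * p.2) / fr σ Q (p.1 + σ * p.2)) (Q.prod gam) :=
    ((hrm.div hfm).comp (f := fun p : ℝ × ℝ => p.1 + σ * p.2) (by fun_prop)).aestronglyMeasurable
  have hρi : Integrable (fun p : ℝ × ℝ => rr σ A δ c (p.1 + σ * p.2) / fr σ Q (p.1 + σ * p.2)) (Q.prod gam) := by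
    refine ⟨hρm, ?_⟩
    rw [hasFiniteIntegral_iff_ofReal (ae_of_all _ fun p => hρ0 _)]
    exact hlint.trans_lt ENNReal.one_lt_top
  have hρ1 : ∫ p, rr σ A δ c (p.1 + σ * p.2) / fr σ Q (p.1 + σ * p.2) ∂(Q.prod gam) ≤ 1 := by
    rw [integral_eq_lintegral_of_nonneg_ae (ae_of_all _ fun p => hρ0 _) hρm]
    exact ENNReal.toReal_le_of_le_ofReal zero_le_one (by simpa using hlint)
  have hki := kk_int hσ hδ hL Q hQ
  have hk1 : ∫ p, kk L (p.1 / σ) ((A - p.1) / σ) (δ / σ) p.2 ∂(Q.prod gam) ≤ B := by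
    rw [integral_prod _ hki]
    have : ∫ x, ∫ t, kk L (x / σ) ((A - x) / σ) (δ / σ) t ∂gam ∂Q ≤ ∫ _, B ∂Q := by
      refine integral_mono_ae hki.integral_prod_left (integrable_const _) ?_
      filter_upwards [Q_ae Q hQ] with x hx
      have := inner_bound (L := L) (ξ := x / σ) (η := (A - x) / σ) (d := δ / σ) hL
        (div_nonneg hx.1 hσ.le) (div_nonneg (by linarith [hx.2]) hσ.le) (div_pos hδ hσ).le
      rw [show δ / σ + (x / σ + (A - x) / σ) / 2 = (δ + A / 2) / σ by ring] at this
      exact this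
    simpa using this
  rw [joint_eq, integral_map hT.aemeasurable (psi_meas Q).aestronglyMeasurable]
  calc ∫ p, psi σ Q (p.1, p.1 + σ * p.2) ∂(Q.prod gam)
      ≤ ∫ p, (kk L (p.1 / σ) ((A - p.1) / σ) (δ / σ) p.2
        + (rr σ A δ c (p.1 + σ * p.2) / fr σ Q (p.1 + σ * p.2) - 1)) ∂(Q.prod gam) := by
        refine integral_mono_ae (psi_int Q hσ hQ) (hki.add (hρi.sub (integrable_const 1))) ?_
        filter_upwards [prod_ae Q hQ] with p hp
        have h1 := log_ratio (t := p.2) hσ hδ hc0 hp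
        rw [hLe] at h1
        have h2 := Real.log_le_sub_one_of_pos
          (div_pos (rr_pos (A := A) (δ := δ) hσ hc0 (p.1 + σ * p.2)) (fr_pos Q hσ hQ (p.1 + σ * p.2)))
        rw [Real.log_div (rr_pos hσ hc0 _).ne' (fr_pos Q hσ hQ _).ne'] at h2
        simp only [psi]
        linarith
    _ ≤ B := by
        rw [integral_add hki (by exact hρi.sub (integrable_const 1)), integral_sub hρi (integrable_const 1)]
        simp only [integral_const, probReal_univ, smul_eq_mul, one_mul]
        linarith

/-- Duality-based upper bound on `C(A, αA)` for `1/2 ≤ α ≤ 1`, with free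
parameter `δ > 0`. -/
theorem capacity_upper_bound_weak_high (σ A α δ : ℝ) (hσ : 0 < σ) (hA : 0 < A)
    (hα₁ : 1 / 2 ≤ α) (hα₂ : α ≤ 1) (hδ : 0 < δ) :
    capacity σ A (α * A) ≤
      (((1 - 2 * Qf ((δ + A / 2) / σ)) *
          Real.log ((A + 2 * δ) / (σ * Real.sqrt (2 * π) * (1 - 2 * Qf (δ / σ))))
        - 1 / 2 + Qf (δ / σ)
        + δ / (Real.sqrt (2 * π) * σ) * rexp (-δ ^ 2 / (2 * σ ^ 2)) : ℝ) : EReal) := by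
  unfold capacity
  refine iSup₂_le fun Q hQ => ?_
  obtain ⟨hP, hQA, -⟩ := hQ
  have hac : jointLaw σ Q ≪ Q.prod (volume.withDensity (fE σ Q)) := by
    rw [joint_prod Q hσ hQA]; exact withDensity_absolutelyContinuous _ _
  have hll := llr_ae Q hσ hQA
  have hint : Integrable (psi σ Q) (jointLaw σ Q) := by
    rw [joint_eq, integrable_map_measure (psi_meas Q).aestronglyMeasurable (by fun_prop)]
    exact psi_int Q hσ hQA
  unfold mutualInfo klDiv
  rw [joint_fst, joint_snd hσ, if_pos ⟨hac, (integrable_congr hll).2 hint⟩, integral_congr_ae hll,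
    EReal.coe_le_coe_iff]
  have h := main_bound hσ hA hδ Q hQA
  have e : δ / σ * ph (δ / σ) = δ / (Real.sqrt (2 * π) * σ) * rexp (-δ ^ 2 / (2 * σ ^ 2)) := by
    unfold ph
    rw [show -(δ / σ) ^ 2 / 2 = -δ ^ 2 / (2 * σ ^ 2) by field_simp]
    field_simp
  rwa [e] at h
end

section
/- For every σ > 0 and every α with 1/2 ≤ α ≤ 1, the low-power asymptotics of capacity is: lim_{A → 0⁺} C(A, αA) / (A²/σ²) = 1/8. -/
open MeasureTheory ProbabilityTheory Real Filter Set
open scoped Classical Topology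

noncomputable def auxL (m v x y : ℝ) : ℝ := ((x - m) / v) * (y - (x + m) / 2)

noncomputable def auxF (m v : ℝ) (p : ℝ × ℝ) : ENNReal :=
  ENNReal.ofReal (Real.exp (auxL m v p.1 p.2))

noncomputable def auxH (Q : Measure ℝ) (m v : ℝ) (y : ℝ) : ENNReal :=
  ∫⁻ x, auxF m v (x, y) ∂Q

noncomputable def auxP (Q : Measure ℝ) (v : NNReal) : Measure (ℝ × ℝ) :=
  (Q.prod (gaussianReal 0 v)).map (fun p => (p.1, p.1 + p.2))

noncomputable def auxB (m v y : ℝ) : ℝ := m / v * (|y - m| + m / 2)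

lemma auxL_meas (m v : ℝ) : Measurable (fun p : ℝ × ℝ => auxL m v p.1 p.2) := by
  unfold auxL; fun_prop

lemma auxF_meas (m v : ℝ) : Measurable (auxF m v) := by
  unfold auxF
  exact (Real.measurable_exp.comp (auxL_meas m v)).ennreal_ofReal

lemma auxH_meas (Q : Measure ℝ) [IsProbabilityMeasure Q] (m v : ℝ) :
    Measurable (auxH Q m v) := by
  unfold auxH
  exact Measurable.lintegral_prod_left (auxF_meas m v)

lemma jmap_meas : Measurable (fun p : ℝ × ℝ => (p.1, p.1 + p.2)) := by fun_prop

lemma auxL_bound {m v x y : ℝ} (hm : 0 < m) (hv : 0 < v) (hx : |x - m| ≤ m) :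
    |auxL m v x y| ≤ auxB m v y := by
  unfold auxL auxB
  rw [abs_mul, abs_div, abs_of_pos hv]
  have h1 : |y - (x + m) / 2| ≤ |y - m| + m / 2 := by
    have : y - (x + m) / 2 = (y - m) - (x - m) / 2 := by ring
    rw [this]
    refine (abs_sub _ _).trans ?_
    rw [abs_div, abs_two]
    linarith
  gcongr

lemma gauss_withDensity (m x : ℝ) (v : NNReal) (hv : v ≠ 0) :
    gaussianReal x v = (gaussianReal m v).withDensity (fun y => auxF m v (x, y)) := by
  have hv' : (v : ℝ) ≠ 0 := by exact_mod_cast hv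
  rw [gaussianReal_of_var_ne_zero _ hv, gaussianReal_of_var_ne_zero _ hv,
    ← withDensity_mul _ (measurable_gaussianPDF _ _) (by exact (auxF_meas m v).comp (by fun_prop))]
  congr 1
  ext y
  simp only [Pi.mul_apply, gaussianPDF, auxF]
  rw [← ENNReal.ofReal_mul (gaussianPDFReal_nonneg _ _ _)]
  congr 1
  unfold gaussianPDFReal auxL
  rw [mul_assoc _ (Real.exp _) (Real.exp _), ← Real.exp_add]
  congr 2
  field_simp
  ring

lemma auxP_eq (Q : Measure ℝ) [IsProbabilityMeasure Q] (m : ℝ) (v : NNReal) (hv : v ≠ 0) :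
    auxP Q v = (Q.prod (gaussianReal m v)).withDensity (auxF m v) := by
  refine Measure.ext_of_lintegral _ fun f hf => ?_
  unfold auxP
  rw [lintegral_map hf jmap_meas, lintegral_prod _ (by exact (hf.comp jmap_meas).aemeasurable),
    lintegral_withDensity_eq_lintegral_mul _ (auxF_meas m v) hf,
    lintegral_prod _ ((auxF_meas m v).mul hf).aemeasurable]
  refine lintegral_congr fun x => ?_
  have hfx : Measurable (fun y => f (x, y)) := hf.comp (by fun_prop)
  have := lintegral_map (μ := gaussianReal 0 v) hfx (measurable_const_add x)
  rw [← this]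
  have h2 := gaussianReal_map_const_add (μ := 0) (v := v) x
  rw [zero_add] at h2
  erw [h2]
  rw [gauss_withDensity m x v hv, lintegral_withDensity_eq_lintegral_mul _
    (by exact (auxF_meas m v).comp (by fun_prop)) hfx]
  rfl

lemma auxP_fst (Q : Measure ℝ) [IsProbabilityMeasure Q] (v : NNReal) :
    (auxP Q v).map Prod.fst = Q := by
  unfold auxP
  rw [Measure.map_map measurable_fst jmap_meas]
  have : (Prod.fst ∘ fun p : ℝ × ℝ => (p.1, p.1 + p.2)) = Prod.fst := rfl
  rw [this, Measure.map_fst_prod]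
  simp

lemma auxP_snd (Q : Measure ℝ) [IsProbabilityMeasure Q] (m : ℝ) (v : NNReal) (hv : v ≠ 0) :
    (auxP Q v).map Prod.snd = (gaussianReal m v).withDensity (auxH Q m v) := by
  refine Measure.ext_of_lintegral _ fun f hf => ?_
  rw [auxP_eq Q m v hv, lintegral_map hf measurable_snd,
    lintegral_withDensity_eq_lintegral_mul _ (auxF_meas m v)
      (g := fun p : ℝ × ℝ => f p.2) (hf.comp measurable_snd),
    lintegral_withDensity_eq_lintegral_mul _ (auxH_meas Q m v) hf,
    lintegral_prod_symm (auxF m v * fun p : ℝ × ℝ => f p.2)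
      ((auxF_meas m v).mul (hf.comp measurable_snd)).aemeasurable]
  refine lintegral_congr fun y => ?_
  simp only [Pi.mul_apply, auxH]
  exact lintegral_mul_const _ ((auxF_meas m v).comp (by fun_prop))

lemma auxH_bounds (Q : Measure ℝ) [IsProbabilityMeasure Q] {m v : ℝ} (hm : 0 < m) (hv : 0 < v)
    (hQ : ∀ᵐ x ∂Q, |x - m| ≤ m) (y : ℝ) :
    ENNReal.ofReal (Real.exp (-auxB m v y)) ≤ auxH Q m v y ∧
      auxH Q m v y ≤ ENNReal.ofReal (Real.exp (auxB m v y)) := by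
  unfold auxH
  constructor
  · calc _ = ∫⁻ x, ENNReal.ofReal (Real.exp (-auxB m v y)) ∂Q := by simp
      _ ≤ _ := by
        apply lintegral_mono_ae
        filter_upwards [hQ] with x hx
        have := abs_le.1 (auxL_bound (y := y) hm hv hx)
        exact ENNReal.ofReal_le_ofReal (Real.exp_le_exp.2 this.1)
  · calc _ ≤ ∫⁻ x, ENNReal.ofReal (Real.exp (auxB m v y)) ∂Q := by
          apply lintegral_mono_ae
          filter_upwards [hQ] with x hx
          have := abs_le.1 (auxL_bound (y := y) hm hv hx)
          exact ENNReal.ofReal_le_ofReal (Real.exp_le_exp.2 this.2)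
      _ = _ := by simp

lemma auxH_ne_zero (Q : Measure ℝ) [IsProbabilityMeasure Q] {m v : ℝ} (hm : 0 < m) (hv : 0 < v)
    (hQ : ∀ᵐ x ∂Q, |x - m| ≤ m) (y : ℝ) : auxH Q m v y ≠ 0 := by
  have := (auxH_bounds Q hm hv hQ y).1
  have h2 : 0 < ENNReal.ofReal (Real.exp (-auxB m v y)) := by
    rw [ENNReal.ofReal_pos]; positivity
  exact (h2.trans_le this).ne'

lemma auxH_ne_top (Q : Measure ℝ) [IsProbabilityMeasure Q] {m v : ℝ} (hm : 0 < m) (hv : 0 < v)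
    (hQ : ∀ᵐ x ∂Q, |x - m| ≤ m) (y : ℝ) : auxH Q m v y ≠ ⊤ :=
  ((auxH_bounds Q hm hv hQ y).2.trans_lt ENNReal.ofReal_lt_top).ne

lemma log_auxH_bound (Q : Measure ℝ) [IsProbabilityMeasure Q] {m v : ℝ} (hm : 0 < m) (hv : 0 < v)
    (hQ : ∀ᵐ x ∂Q, |x - m| ≤ m) (y : ℝ) :
    |Real.log (auxH Q m v y).toReal| ≤ auxB m v y := by
  have hb := auxH_bounds Q hm hv hQ y
  have ht := auxH_ne_top Q hm hv hQ y
  have h1 : Real.exp (-auxB m v y) ≤ (auxH Q m v y).toReal :=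
    (ENNReal.ofReal_le_iff_le_toReal ht).1 hb.1
  have h2 : (auxH Q m v y).toReal ≤ Real.exp (auxB m v y) :=
    ENNReal.toReal_le_of_le_ofReal (Real.exp_pos _).le hb.2
  have h0 : 0 < (auxH Q m v y).toReal := (Real.exp_pos _).trans_le h1
  rw [abs_le]
  exact ⟨(Real.le_log_iff_exp_le h0).2 h1, (Real.log_le_iff_le_exp h0).2 h2⟩

lemma auxP_eq2 (Q : Measure ℝ) [IsProbabilityMeasure Q] {m : ℝ} (v : NNReal) (hv : v ≠ 0)
    (hm : 0 < m) (hQ : ∀ᵐ x ∂Q, |x - m| ≤ m) :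
    auxP Q v = (((auxP Q v).map Prod.fst).prod ((auxP Q v).map Prod.snd)).withDensity
      (fun p => auxF m v p * (auxH Q m v p.2)⁻¹) := by
  have hv' : (0 : ℝ) < v := by exact_mod_cast pos_iff_ne_zero.2 hv
  rw [auxP_fst, auxP_snd Q m v hv, prod_withDensity_right (auxH_meas Q m v),
    ← withDensity_mul _ (f := fun z : ℝ × ℝ => auxH Q m v z.2)
      (g := fun p : ℝ × ℝ => auxF m v p * (auxH Q m v p.2)⁻¹) ((auxH_meas Q m v).comp measurable_snd)
      ((auxF_meas m v).mul ((auxH_meas Q m v).comp measurable_snd).inv), auxP_eq Q m v hv]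
  congr 1
  ext p
  simp only [Pi.mul_apply]
  rw [mul_comm, mul_assoc, ENNReal.inv_mul_cancel (auxH_ne_zero Q hm hv' hQ _)
    (auxH_ne_top Q hm hv' hQ _), mul_one]

instance auxP_prob (Q : Measure ℝ) [IsProbabilityMeasure Q] (v : NNReal) :
    IsProbabilityMeasure (auxP Q v) :=
  Measure.isProbabilityMeasure_map jmap_meas.aemeasurable

lemma llr_auxP (Q : Measure ℝ) [IsProbabilityMeasure Q] {m : ℝ} (v : NNReal) (hv : v ≠ 0)
    (hm : 0 < m) (hQ : ∀ᵐ x ∂Q, |x - m| ≤ m) :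
    (auxP Q v ≪ ((auxP Q v).map Prod.fst).prod ((auxP Q v).map Prod.snd)) ∧
    llr (auxP Q v) (((auxP Q v).map Prod.fst).prod ((auxP Q v).map Prod.snd)) =ᵐ[auxP Q v]
      (fun p => auxL m v p.1 p.2 - Real.log (auxH Q m v p.2).toReal) := by
  have hv' : (0 : ℝ) < v := by exact_mod_cast pos_iff_ne_zero.2 hv
  have h := auxP_eq2 Q v hv hm hQ
  have i1 : IsProbabilityMeasure ((auxP Q v).map Prod.fst) :=
    Measure.isProbabilityMeasure_map measurable_fst.aemeasurable
  have i2 : IsProbabilityMeasure ((auxP Q v).map Prod.snd) :=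
    Measure.isProbabilityMeasure_map measurable_snd.aemeasurable
  set R := ((auxP Q v).map Prod.fst).prod ((auxP Q v).map Prod.snd) with hR
  have hac : auxP Q v ≪ R := by
    rw [h]; exact withDensity_absolutelyContinuous _ _
  refine ⟨hac, ?_⟩
  have hd : (auxP Q v).rnDeriv R =ᵐ[R] (fun p => auxF m v p * (auxH Q m v p.2)⁻¹) := by
    have := Measure.rnDeriv_withDensity R (f := fun p => auxF m v p * (auxH Q m v p.2)⁻¹)
      ((auxF_meas m v).mul ((auxH_meas Q m v).comp measurable_snd).inv)
    rwa [← h] at this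
  filter_upwards [hac.ae_le hd] with p hp
  simp only [llr, hp]
  have h0 := ENNReal.toReal_pos (auxH_ne_zero Q hm hv' hQ p.2) (auxH_ne_top Q hm hv' hQ p.2)
  rw [ENNReal.toReal_mul, ENNReal.toReal_inv, auxF, ENNReal.toReal_ofReal (Real.exp_pos _).le,
    Real.log_mul (Real.exp_pos _).ne' (inv_pos.2 h0).ne', Real.log_exp, Real.log_inv]
  ring

lemma int_z (v : NNReal) : Integrable (fun z : ℝ => z) (gaussianReal 0 v) :=
  (memLp_id_gaussianReal (μ := 0) (v := v) 1).integrable (by simp)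

lemma int_z2 (v : NNReal) : Integrable (fun z : ℝ => z ^ 2) (gaussianReal 0 v) :=
  (memLp_id_gaussianReal (μ := 0) (v := v) 2).integrable_sq

lemma integral_z2 (v : NNReal) : ∫ z, z ^ 2 ∂(gaussianReal 0 v) = v := by
  have h := variance_eq_sub (memLp_id_gaussianReal (μ := 0) (v := v) 2)
  rw [variance_id_gaussianReal] at h
  simpa using h.symm

lemma ae_prod_fst {Q : Measure ℝ} [IsProbabilityMeasure Q] (v : NNReal) {p : ℝ → Prop}
    (h : ∀ᵐ x ∂Q, p x) : ∀ᵐ w ∂(Q.prod (gaussianReal 0 v)), p w.1 :=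
  Measure.quasiMeasurePreserving_fst.ae h

lemma int_B (Q : Measure ℝ) [IsProbabilityMeasure Q] {m : ℝ} (v : NNReal) (hv : v ≠ 0)
    (hm : 0 < m) (hQ : ∀ᵐ x ∂Q, |x - m| ≤ m) {g : ℝ × ℝ → ℝ} (hg : Measurable g)
    (hb : ∀ᵐ w ∂(Q.prod (gaussianReal 0 v)), |g w| ≤ auxB m v (w.1 + w.2)) :
    Integrable g (Q.prod (gaussianReal 0 v)) := by
  have hv' : (0 : ℝ) < v := by exact_mod_cast pos_iff_ne_zero.2 hv
  have hi : Integrable (fun w : ℝ × ℝ => m / v * (|w.2| + 2 * m)) (Q.prod (gaussianReal 0 v)) :=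
    ((((int_z v).abs.comp_snd Q)).add (integrable_const (2 * m))).const_mul _
  refine hi.mono' hg.aestronglyMeasurable ?_
  filter_upwards [hb, ae_prod_fst v hQ] with w hw hx
  refine hw.trans ?_
  unfold auxB
  have : |w.1 + w.2 - m| ≤ |w.1 - m| + |w.2| := by
    have : w.1 + w.2 - m = (w.1 - m) + w.2 := by ring
    rw [this]; exact abs_add_le _ _
  have h3 : |w.1 + w.2 - m| + m / 2 ≤ |w.2| + 2 * m := by linarith
  exact mul_le_mul_of_nonneg_left h3 (by positivity)

lemma int_L (Q : Measure ℝ) [IsProbabilityMeasure Q] {m : ℝ} (v : NNReal) (hv : v ≠ 0)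
    (hm : 0 < m) (hQ : ∀ᵐ x ∂Q, |x - m| ≤ m) :
    Integrable (fun w : ℝ × ℝ => auxL m v w.1 (w.1 + w.2)) (Q.prod (gaussianReal 0 v)) := by
  have hv' : (0 : ℝ) < v := by exact_mod_cast pos_iff_ne_zero.2 hv
  refine int_B Q v hv hm hQ ((auxL_meas m v).comp jmap_meas) ?_
  filter_upwards [ae_prod_fst v hQ] with w hx
  exact auxL_bound hm hv' hx

lemma int_H (Q : Measure ℝ) [IsProbabilityMeasure Q] {m : ℝ} (v : NNReal) (hv : v ≠ 0)
    (hm : 0 < m) (hQ : ∀ᵐ x ∂Q, |x - m| ≤ m) :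
    Integrable (fun w : ℝ × ℝ => Real.log (auxH Q m v (w.1 + w.2)).toReal)
      (Q.prod (gaussianReal 0 v)) := by
  have hv' : (0 : ℝ) < v := by exact_mod_cast pos_iff_ne_zero.2 hv
  refine int_B Q v hv hm hQ ?_ (ae_of_all _ fun w => log_auxH_bound Q hm hv' hQ _)
  exact Real.measurable_log.comp ((auxH_meas Q m v).comp (by fun_prop)).ennreal_toReal

lemma mi_eq (Q : Measure ℝ) [IsProbabilityMeasure Q] {m : ℝ} (v : NNReal) (hv : v ≠ 0)
    (hm : 0 < m) (hQ : ∀ᵐ x ∂Q, |x - m| ≤ m) :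
    klDiv (auxP Q v) (((auxP Q v).map Prod.fst).prod ((auxP Q v).map Prod.snd)) =
      ((∫ w, auxL m v w.1 (w.1 + w.2) ∂(Q.prod (gaussianReal 0 v)) -
        ∫ w, Real.log (auxH Q m v (w.1 + w.2)).toReal ∂(Q.prod (gaussianReal 0 v)) : ℝ) :
        EReal) := by
  obtain ⟨hac, hllr⟩ := llr_auxP Q v hv hm hQ
  have hme : Measurable (fun p : ℝ × ℝ => auxL m v p.1 p.2 - Real.log (auxH Q m v p.2).toReal) :=
    (auxL_meas m v).sub
      (Real.measurable_log.comp ((auxH_meas Q m v).comp measurable_snd).ennreal_toReal)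
  have hint : Integrable (fun p : ℝ × ℝ => auxL m v p.1 p.2 - Real.log (auxH Q m v p.2).toReal)
      (auxP Q v) := by
    unfold auxP
    rw [integrable_map_measure hme.aestronglyMeasurable jmap_meas.aemeasurable]
    exact (int_L Q v hv hm hQ).sub (int_H Q v hv hm hQ)
  unfold klDiv
  rw [if_pos ⟨hac, (integrable_congr hllr).2 hint⟩, integral_congr_ae hllr]
  congr 1
  rw [← integral_sub (int_L Q v hv hm hQ) (int_H Q v hv hm hQ)]
  unfold auxP
  rw [integral_map jmap_meas.aemeasurable hme.aestronglyMeasurable]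

lemma integral_logH_nonneg (Q : Measure ℝ) [IsProbabilityMeasure Q] {m : ℝ} (v : NNReal)
    (hv : v ≠ 0) (hm : 0 < m) (hQ : ∀ᵐ x ∂Q, |x - m| ≤ m) :
    0 ≤ ∫ w, Real.log (auxH Q m v (w.1 + w.2)).toReal ∂(Q.prod (gaussianReal 0 v)) := by
  have hv' : (0 : ℝ) < v := by exact_mod_cast pos_iff_ne_zero.2 hv
  have hms : Measurable (fun w : ℝ × ℝ => (auxH Q m v (w.1 + w.2))⁻¹) :=
    ((auxH_meas Q m v).comp (by fun_prop)).inv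
  have h1 : ∫⁻ w, (auxH Q m v (w.1 + w.2))⁻¹ ∂(Q.prod (gaussianReal 0 v)) = 1 := by
    have e1 : ∫⁻ w, (auxH Q m v (w.1 + w.2))⁻¹ ∂(Q.prod (gaussianReal 0 v)) =
        ∫⁻ y, (auxH Q m v y)⁻¹ ∂((auxP Q v).map Prod.snd) := by
      unfold auxP
      rw [lintegral_map (f := fun y => (auxH Q m v y)⁻¹) (auxH_meas Q m v).inv measurable_snd,
        lintegral_map (f := fun p : ℝ × ℝ => (auxH Q m v p.2)⁻¹) ((auxH_meas Q m v).inv.comp measurable_snd) jmap_meas]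
    rw [e1, auxP_snd Q m v hv, lintegral_withDensity_eq_lintegral_mul _ (auxH_meas Q m v)
      (g := fun y => (auxH Q m v y)⁻¹) (auxH_meas Q m v).inv]
    have : ∀ y, (auxH Q m v * fun y => (auxH Q m v y)⁻¹) y = 1 := fun y =>
      ENNReal.mul_inv_cancel (auxH_ne_zero Q hm hv' hQ _) (auxH_ne_top Q hm hv' hQ _)
    simp only [this]
    simp
  have hi := integrable_toReal_of_lintegral_ne_top hms.aemeasurable (by rw [h1]; simp)
  have h2 : ∫ w, ((auxH Q m v (w.1 + w.2))⁻¹).toReal ∂(Q.prod (gaussianReal 0 v)) = 1 := by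
    rw [integral_toReal hms.aemeasurable, h1]
    · simp
    · exact ae_of_all _ fun w => by simpa [pos_iff_ne_zero] using auxH_ne_zero Q hm hv' hQ _
  calc (0 : ℝ) = ∫ w, (1 - ((auxH Q m v (w.1 + w.2))⁻¹).toReal) ∂(Q.prod (gaussianReal 0 v)) := by
        rw [integral_sub (integrable_const _) hi, h2]; simp
    _ ≤ _ := by
      refine integral_mono ((integrable_const _).sub hi) (int_H Q v hv hm hQ) fun w => ?_
      simp only [ENNReal.toReal_inv]
      exact Real.one_sub_inv_le_log_of_pos
        (ENNReal.toReal_pos (auxH_ne_zero Q hm hv' hQ _) (auxH_ne_top Q hm hv' hQ _))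

lemma int_x {Q : Measure ℝ} [IsProbabilityMeasure Q] {m : ℝ}
    (hQ : ∀ᵐ x ∂Q, |x - m| ≤ m) : Integrable (fun x => x - m) Q :=
  Integrable.of_bound (by fun_prop) m hQ

lemma int_x2 {Q : Measure ℝ} [IsProbabilityMeasure Q] {m : ℝ}
    (hQ : ∀ᵐ x ∂Q, |x - m| ≤ m) : Integrable (fun x => (x - m) ^ 2) Q := by
  refine Integrable.of_bound (by fun_prop) (m ^ 2) ?_
  filter_upwards [hQ] with x hx
  rw [Real.norm_eq_abs, abs_pow]
  gcongr

lemma integral_L (Q : Measure ℝ) [IsProbabilityMeasure Q] {m : ℝ} (v : NNReal) (hv : v ≠ 0)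
    (hQ : ∀ᵐ x ∂Q, |x - m| ≤ m) :
    ∫ w, auxL m v w.1 (w.1 + w.2) ∂(Q.prod (gaussianReal 0 v)) =
      (∫ x, (x - m) ^ 2 ∂Q) / (2 * v) := by
  have hv' : (v : ℝ) ≠ 0 := by exact_mod_cast hv
  have e : (fun w : ℝ × ℝ => auxL m v w.1 (w.1 + w.2)) =
      fun w => (v : ℝ)⁻¹ * ((w.1 - m) * w.2) + (2 * (v : ℝ))⁻¹ * (w.1 - m) ^ 2 := by
    ext w; unfold auxL; field_simp; ring
  rw [e, integral_add (((int_x hQ).mul_prod (int_z v)).const_mul _)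
    (((int_x2 hQ).comp_fst _).const_mul _), integral_const_mul, integral_const_mul,
    integral_prod_mul (fun x => x - m) (fun z => z), integral_id_gaussianReal,
    integral_fun_fst (fun x => (x - m) ^ 2)]
  simp
  field_simp

lemma upper (Q : Measure ℝ) [IsProbabilityMeasure Q] {m : ℝ} (v : NNReal) (hv : v ≠ 0)
    (hm : 0 < m) (hQ : ∀ᵐ x ∂Q, |x - m| ≤ m) :
    klDiv (auxP Q v) (((auxP Q v).map Prod.fst).prod ((auxP Q v).map Prod.snd)) ≤
      ((m ^ 2 / (2 * v) : ℝ) : EReal) := by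
  rw [mi_eq Q v hv hm hQ, integral_L Q v hv hQ]
  have h0 := integral_logH_nonneg Q v hv hm hQ
  have h1 : ∫ x, (x - m) ^ 2 ∂Q ≤ m ^ 2 := by
    calc _ ≤ ∫ _, m ^ 2 ∂Q := by
          refine integral_mono_ae (int_x2 hQ) (integrable_const _) ?_
          filter_upwards [hQ] with x hx
          exact sq_le_sq' (abs_le.1 hx).1 (abs_le.1 hx).2
      _ = _ := by simp
  rw [EReal.coe_le_coe_iff]
  have : (∫ x, (x - m) ^ 2 ∂Q) / (2 * v) ≤ m ^ 2 / (2 * v) := by gcongr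
  linarith

noncomputable def Q2 (m : ℝ) : Measure ℝ :=
  (2 : ENNReal)⁻¹ • Measure.dirac 0 + (2 : ENNReal)⁻¹ • Measure.dirac (2 * m)

instance Q2_prob (m : ℝ) : IsProbabilityMeasure (Q2 m) :=
  ⟨by simp [Q2, ENNReal.inv_two_add_inv_two]⟩

lemma Q2_ae (m : ℝ) : ∀ᵐ x ∂(Q2 m), x = 0 ∨ x = 2 * m := by
  have hm : MeasurableSet {x : ℝ | x = 0 ∨ x = 2 * m} :=
    (measurableSet_singleton 0).union (measurableSet_singleton (2 * m))
  unfold Q2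
  rw [ae_add_measure_iff]
  constructor
  · refine Measure.ae_smul_measure ?_ _
    rw [ae_dirac_iff hm]; simp
  · refine Measure.ae_smul_measure ?_ _
    rw [ae_dirac_iff hm]; simp

lemma Q2_H {m : ℝ} (v y : ℝ) (hv : 0 < v) : Real.log (auxH (Q2 m) m v y).toReal ≤
    -(m ^ 2 / (2 * v)) + m ^ 2 / (2 * v ^ 2) * (y - m) ^ 2 := by
  have hH : (auxH (Q2 m) m v y).toReal =
      Real.exp (-(m ^ 2 / (2 * v))) * Real.cosh (m / v * (y - m)) := by
    unfold auxH Q2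
    rw [lintegral_add_measure, lintegral_smul_measure, lintegral_smul_measure, lintegral_dirac,
      lintegral_dirac]
    unfold auxF
    simp only [smul_eq_mul]
    rw [ENNReal.toReal_add (by finiteness) (by finiteness), ENNReal.toReal_mul, ENNReal.toReal_mul,
      ENNReal.toReal_ofReal (Real.exp_pos _).le, ENNReal.toReal_ofReal (Real.exp_pos _).le,
      Real.cosh_eq]
    have a : auxL m v 0 y = -(m ^ 2 / (2 * v)) + -(m / v * (y - m)) := by
      unfold auxL; field_simp; ring
    have b : auxL m v (2 * m) y = -(m ^ 2 / (2 * v)) + (m / v * (y - m)) := by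
      unfold auxL; field_simp; ring
    rw [a, b, Real.exp_add, Real.exp_add]
    simp
    ring
  have hpos : 0 < (auxH (Q2 m) m v y).toReal := by
    rw [hH]; exact mul_pos (Real.exp_pos _) (Real.cosh_pos _)
  rw [Real.log_le_iff_le_exp hpos, hH, Real.exp_add]
  gcongr
  refine (Real.cosh_le_exp_half_sq _).trans (le_of_eq ?_)
  congr 1
  field_simp

lemma lower {m : ℝ} (v : NNReal) (hv : v ≠ 0) (hm : 0 < m) :
    ((m ^ 2 / (2 * v) - m ^ 4 / (2 * v ^ 2) : ℝ) : EReal) ≤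
    klDiv (auxP (Q2 m) v) (((auxP (Q2 m) v).map Prod.fst).prod ((auxP (Q2 m) v).map Prod.snd)) := by
  have hv' : (0 : ℝ) < v := by exact_mod_cast pos_iff_ne_zero.2 hv
  have hsq : ∀ᵐ x ∂(Q2 m), (x - m) ^ 2 = m ^ 2 := by
    filter_upwards [Q2_ae m] with x hx
    rcases hx with rfl | rfl <;> ring
  have hQ : ∀ᵐ x ∂(Q2 m), |x - m| ≤ m := by
    filter_upwards [hsq] with x hx
    exact abs_le_of_sq_le_sq hx.le hm.le
  have hI : ∫ x, (x - m) ^ 2 ∂(Q2 m) = m ^ 2 := by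
    rw [integral_congr_ae hsq]; simp
  rw [mi_eq (Q2 m) v hv hm hQ, integral_L (Q2 m) v hv hQ, hI, EReal.coe_le_coe_iff]
  have i1 := (int_x2 hQ).comp_fst (gaussianReal 0 v)
  have i2 := ((int_x hQ).mul_prod (int_z v)).const_mul 2
  have i3 := (int_z2 v).comp_snd (Q2 m)
  have i4 := ((i1.add i2).add i3).const_mul (m ^ 2 / (2 * (v : ℝ) ^ 2))
  have key : ∫ w, Real.log (auxH (Q2 m) m v (w.1 + w.2)).toReal ∂((Q2 m).prod (gaussianReal 0 v)) ≤
      m ^ 4 / (2 * v ^ 2) := by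
    calc _ ≤ ∫ w : ℝ × ℝ, (-(m ^ 2 / (2 * v)) + m ^ 2 / (2 * (v : ℝ) ^ 2) *
            ((w.1 - m) ^ 2 + 2 * ((w.1 - m) * w.2) + w.2 ^ 2)) ∂((Q2 m).prod (gaussianReal 0 v)) := by
          refine integral_mono (int_H (Q2 m) v hv hm hQ) ((integrable_const _).add i4) fun w => ?_
          refine (Q2_H v (w.1 + w.2) hv').trans (le_of_eq ?_)
          ring
      _ = -(m ^ 2 / (2 * v)) + m ^ 2 / (2 * (v : ℝ) ^ 2) * (m ^ 2 + 2 * (0) + v) := by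
          have e0 := integral_add (integrable_const (μ := (Q2 m).prod (gaussianReal 0 v))
            (-(m ^ 2 / (2 * (v : ℝ))))) i4
          have e1 := integral_add (i1.add i2) i3
          have e2 := integral_add i1 i2
          simp only [Pi.add_apply] at e0 e1 e2
          rw [e0, integral_const_mul, e1, e2, integral_const_mul,
            integral_prod_mul (fun x => x - m) (fun z => z), integral_id_gaussianReal,
            integral_fun_fst (fun x => (x - m) ^ 2), integral_fun_snd (fun x => x ^ 2), hI,
            integral_z2]
          simp
      _ = _ := by field_simp; ring
  linarith

lemma cap_upper {σ A E : ℝ} (hσ : 0 < σ) (hA : 0 < A) :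
    capacity σ A E ≤ ((A ^ 2 / (8 * σ ^ 2) : ℝ) : EReal) := by
  unfold capacity
  refine iSup₂_le fun Q hQ => ?_
  obtain ⟨h1, h2, -⟩ := hQ
  have hae : ∀ᵐ x ∂Q, |x - A / 2| ≤ A / 2 := by
    have : ∀ᵐ x ∂Q, x ∈ Set.Icc 0 A := (prob_compl_eq_zero_iff measurableSet_Icc).2 h2
    filter_upwards [this] with x hx
    rw [abs_le]; constructor <;> linarith [hx.1, hx.2]
  have hv : (⟨σ ^ 2, sq_nonneg σ⟩ : NNReal) ≠ 0 := by
    intro h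
    have := congrArg NNReal.toReal h
    change σ ^ 2 = 0 at this
    exact (pow_pos hσ 2).ne' this
  refine (upper Q (m := A / 2) ⟨σ ^ 2, sq_nonneg σ⟩ hv (by positivity) hae).trans (le_of_eq ?_)
  congr 1
  change (A / 2) ^ 2 / (2 * σ ^ 2) = _
  field_simp
  norm_num

lemma cap_lower {σ A E : ℝ} (hσ : 0 < σ) (hA : 0 < A) (hE : A / 2 ≤ E) :
    ((A ^ 2 / (8 * σ ^ 2) - A ^ 4 / (32 * σ ^ 4) : ℝ) : EReal) ≤ capacity σ A E := by
  have hv : (⟨σ ^ 2, sq_nonneg σ⟩ : NNReal) ≠ 0 := by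
    intro h
    have := congrArg NNReal.toReal h
    change σ ^ 2 = 0 at this
    exact (pow_pos hσ 2).ne' this
  unfold capacity
  refine le_trans ?_ (le_iSup₂ (Q2 (A / 2)) ⟨inferInstance, ?_, ?_⟩)
  · refine le_trans (le_of_eq ?_) (lower (m := A / 2) ⟨σ ^ 2, sq_nonneg σ⟩ hv (by positivity))
    congr 1
    change _ = (A / 2) ^ 2 / (2 * σ ^ 2) - (A / 2) ^ 4 / (2 * (σ ^ 2) ^ 2)
    field_simp
    ring
  · have : ∀ᵐ x ∂(Q2 (A / 2)), x ∈ Set.Icc 0 A := by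
      filter_upwards [Q2_ae (A / 2)] with x hx
      rcases hx with rfl | rfl <;> constructor <;> linarith
    exact (prob_compl_eq_zero_iff measurableSet_Icc).1 this
  · unfold Q2
    rw [lintegral_add_measure, lintegral_smul_measure, lintegral_smul_measure, lintegral_dirac,
      lintegral_dirac]
    refine le_trans (le_of_eq ?_) (ENNReal.ofReal_le_ofReal hE)
    rw [mul_div_cancel₀ _ (two_ne_zero), ENNReal.ofReal_div_of_pos two_pos]
    simp [ENNReal.div_eq_inv_mul]

/-- Low-power asymptotics of `C(A, αA)` for `1/2 ≤ α ≤ 1`: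
`C(A, αA)/(A²/σ²) → 1/8` as `A → 0⁺`. -/
theorem capacity_low_power_asymptotics_weak (σ α : ℝ) (hσ : 0 < σ)
    (hα₁ : 1 / 2 ≤ α) (hα₂ : α ≤ 1) :
    Tendsto (fun A : ℝ => capacity σ A (α * A) / ((A ^ 2 / σ ^ 2 : ℝ) : EReal))
      (𝓝[>] 0) (𝓝 ((1 / 8 : ℝ) : EReal)) := by
  have hlim : Tendsto (fun A : ℝ => ((1 / 8 - A ^ 2 / (32 * σ ^ 2) : ℝ) : EReal)) (𝓝[>] 0)
      (𝓝 ((1 / 8 : ℝ) : EReal)) := by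
    refine (continuous_coe_real_ereal.tendsto _).comp ?_
    have : Continuous (fun A : ℝ => 1 / 8 - A ^ 2 / (32 * σ ^ 2)) := by fun_prop
    have h := (this.tendsto 0).mono_left (nhdsWithin_le_nhds (s := Set.Ioi 0))
    simpa using h
  refine tendsto_of_tendsto_of_tendsto_of_le_of_le' hlim tendsto_const_nhds ?_ ?_
  · filter_upwards [self_mem_nhdsWithin] with A hA
    have hA : 0 < A := hA
    have h := EReal.div_le_div_right_of_nonneg (c := ((A ^ 2 / σ ^ 2 : ℝ) : EReal))
      (EReal.coe_nonneg.2 (by positivity)) (cap_lower (E := α * A) hσ hA (by nlinarith))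
    refine le_trans (le_of_eq ?_) h
    rw [← EReal.coe_div]
    congr 1
    field_simp
  · filter_upwards [self_mem_nhdsWithin] with A hA
    have hA : 0 < A := hA
    have h := EReal.div_le_div_right_of_nonneg (c := ((A ^ 2 / σ ^ 2 : ℝ) : EReal))
      (EReal.coe_nonneg.2 (by positivity)) (cap_upper (E := α * A) hσ hA)
    refine h.trans (le_of_eq ?_)
    rw [← EReal.coe_div]
    congr 1
    field_simp
end

section
/- For every σ > 0 and E > 0, the average-power-constrained capacity is lower-bounded as C(E) ≥ (1/2)·log( 1 + E²·e/(2πσ²) ). -/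
open MeasureTheory ProbabilityTheory Real Filter Set
open scoped Classical Topology

/-- Capacity `C(E)` of the channel `Y = X + Z`, `Z ~ N(0, σ²)`, with only an
average-power constraint: `P(X ≥ 0) = 1` and `E[X] ≤ E`. -/
noncomputable def capacityAvg (σ E : ℝ) : EReal :=
  ⨆ Q ∈ {Q : Measure ℝ | IsProbabilityMeasure Q ∧ Q (Set.Ici 0) = 1 ∧
      ∫⁻ x, ENNReal.ofReal x ∂Q ≤ ENNReal.ofReal E}, mutualInfo σ Q

namespace CapAux

/-- standard normal cdf -/
noncomputable def Phi (a : ℝ) : ℝ := cdf (gaussianReal 0 1) a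

/-- standard normal density -/
noncomputable def phi (a : ℝ) : ℝ := gaussianPDFReal 0 1 a

lemma phi_pos (a : ℝ) : 0 < phi a := gaussianPDFReal_pos _ _ _ one_ne_zero

lemma phi_eq (a : ℝ) : phi a = (√(2 * π))⁻¹ * rexp (-a ^ 2 / 2) := by
  simp [phi, gaussianPDFReal]

lemma phi_cont : Continuous phi := by
  have : phi = fun a => (√(2 * π))⁻¹ * rexp (-a ^ 2 / 2) := funext phi_eq
  rw [this]; fun_prop

lemma log_phi (a : ℝ) : log (phi a) = - (1 / 2 * log (2 * π)) - a ^ 2 / 2 := by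
  rw [phi_eq, log_mul (by positivity) (by positivity), log_exp, log_inv, log_sqrt (by positivity)]
  ring

lemma phi_int : Integrable phi := integrable_gaussianPDFReal 0 1

lemma Phi_eq (a : ℝ) : Phi a = ∫ x in Iic a, phi x := by
  rw [Phi, cdf_eq_real, measureReal_def, gaussianReal_apply_eq_integral 0 one_ne_zero,
    ENNReal.toReal_ofReal]
  · rfl
  · exact integral_nonneg fun x => gaussianPDFReal_nonneg _ _ _

lemma Phi_deriv (a : ℝ) : HasDerivAt Phi (phi a) a := by
  have h : Phi = fun x => Phi 0 + ∫ t in (0:ℝ)..x, phi t := by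
    funext x
    rw [← intervalIntegral.integral_Iic_sub_Iic phi_int.integrableOn phi_int.integrableOn,
      Phi_eq, Phi_eq]
    ring
  rw [h]
  exact (intervalIntegral.integral_hasDerivAt_right (phi_cont.intervalIntegrable _ _)
    (phi_cont.stronglyMeasurableAtFilter _ _) phi_cont.continuousAt).const_add _

lemma Phi_le_one (a : ℝ) : Phi a ≤ 1 := cdf_le_one _ a

lemma Phi_strictMono : StrictMono Phi :=
  strictMono_of_deriv_pos fun x => by rw [(Phi_deriv x).deriv]; exact phi_pos x

lemma Phi_pos (a : ℝ) : 0 < Phi a :=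
  lt_of_le_of_lt (cdf_nonneg _ (a - 1)) (Phi_strictMono (sub_one_lt a))

lemma Phi_cont : Continuous Phi :=
  continuous_iff_continuousAt.2 fun x => (Phi_deriv x).continuousAt

/-- minus log of cdf -/
noncomputable def nl (a : ℝ) : ℝ := - log (Phi a)

lemma nl_nonneg (a : ℝ) : 0 ≤ nl a := by
  have := log_nonpos (Phi_pos a).le (Phi_le_one a)
  unfold nl; linarith

lemma nl_deriv (a : ℝ) : HasDerivAt nl (- (phi a / Phi a)) a :=
  ((Phi_deriv a).log (Phi_pos a).ne').neg

lemma nl_cont : Continuous nl :=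
  continuous_iff_continuousAt.2 fun x => (nl_deriv x).continuousAt

lemma nl_prim (a : ℝ) : HasDerivAt (fun a => Phi a - Phi a * log (Phi a)) (phi a * nl a) a := by
  have h := (Phi_deriv a).sub ((Phi_deriv a).mul ((Phi_deriv a).log (Phi_pos a).ne'))
  convert! h using 1
  have := (Phi_pos a).ne'
  unfold nl
  field_simp
  ring

lemma nl_bot : Tendsto (fun a => Phi a - Phi a * log (Phi a)) atBot (𝓝 0) := by
  have h : Continuous fun u : ℝ => u - u * log u := continuous_id.sub continuous_mul_log
  have := (h.tendsto 0).comp (tendsto_cdf_atBot (gaussianReal 0 1))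
  simpa using! this

lemma nl_top : Tendsto (fun a => Phi a - Phi a * log (Phi a)) atTop (𝓝 1) := by
  have h : Continuous fun u : ℝ => u - u * log u := continuous_id.sub continuous_mul_log
  have := (h.tendsto 1).comp (tendsto_cdf_atTop (gaussianReal 0 1))
  simpa using! this

lemma nl_int_vol : Integrable (fun a => phi a * nl a) := by
  have hc : Continuous (fun a => phi a * nl a) := phi_cont.mul nl_cont
  refine integrable_of_intervalIntegral_norm_tendsto (a := fun n : ℝ => -n) (b := fun n : ℝ => n)
    (l := atTop) 1
    (fun i => (hc.integrableOn_Icc).mono_set Ioc_subset_Icc_self) tendsto_neg_atTop_atBot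
    tendsto_id ?_
  have : ∀ n : ℝ, ∫ x in -n..n, ‖phi x * nl x‖ =
      (Phi n - Phi n * log (Phi n)) - (Phi (-n) - Phi (-n) * log (Phi (-n))) := by
    intro n
    have : ∀ x, ‖phi x * nl x‖ = phi x * nl x := fun x =>
      Real.norm_of_nonneg (mul_nonneg (phi_pos x).le (nl_nonneg x))
    simp_rw [this]
    exact intervalIntegral.integral_eq_sub_of_hasDerivAt (fun x _ => nl_prim x)
      (hc.intervalIntegrable _ _)
  simp_rw [this]
  have h2 := nl_top.sub (nl_bot.comp tendsto_neg_atTop_atBot)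
  simpa using! h2

lemma nl_integral_vol : ∫ a, phi a * nl a = 1 := by
  rw [integral_of_hasDerivAt_of_tendsto nl_prim nl_int_vol nl_bot nl_top]; ring

lemma gauss_eq : gaussianReal 0 1 = volume.withDensity (fun x => ENNReal.ofReal (phi x)) :=
  gaussianReal_of_var_ne_zero 0 one_ne_zero

lemma nl_int : Integrable nl (gaussianReal 0 1) := by
  rw [gauss_eq, integrable_withDensity_iff_integrable_smul' (by have := phi_cont; fun_prop) (by simp)]
  refine nl_int_vol.congr (ae_of_all _ fun x => ?_)
  simp [ENNReal.toReal_ofReal (phi_pos x).le]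

lemma nl_integral : ∫ a, nl a ∂(gaussianReal 0 1) = 1 := by
  rw [integral_gaussianReal_eq_integral_smul one_ne_zero]
  exact nl_integral_vol

lemma sq_int : Integrable (fun x : ℝ => x ^ 2) (gaussianReal 0 1) :=
  (memLp_id_gaussianReal 2).integrable_sq

lemma sq_integral : ∫ x, x ^ 2 ∂(gaussianReal 0 1) = 1 := by
  have h := variance_fun_id_gaussianReal (μ := 0) (v := 1)
  rw [variance_of_integral_eq_zero (by fun_prop) (by simp)] at h
  simpa using h

section density

variable {σ : ℝ} {Q : Measure ℝ}

/-- noise variance -/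
noncomputable def vr (σ : ℝ) : NNReal := ⟨σ ^ 2, sq_nonneg σ⟩

lemma vr_ne (hσ : 0 < σ) : vr σ ≠ 0 := by
  intro h
  have : (vr σ : ℝ) = 0 := by rw [h]; rfl
  have h2 : (vr σ : ℝ) = σ ^ 2 := rfl
  rw [h2] at this
  have h3 : 0 < σ ^ 2 := by positivity
  exact h3.ne' this

lemma jointLaw_eq (σ : ℝ) (Q : Measure ℝ) : jointLaw σ Q =
    (Q.prod (gaussianReal 0 (vr σ))).map (fun p => (p.1, p.1 + p.2)) := rfl

lemma joint_density (hσ : 0 < σ) [IsProbabilityMeasure Q] :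
    jointLaw σ Q = (Q.prod volume).withDensity (fun p => gaussianPDF 0 (vr σ) (p.2 - p.1)) := by
  have hg := measurable_gaussianPDF 0 (vr σ)
  have hm : Measurable (fun p : ℝ × ℝ => gaussianPDF 0 (vr σ) (p.2 - p.1)) := by fun_prop
  have h1 : jointLaw σ Q = ((Q.prod volume).withDensity
      (fun p => gaussianPDF 0 (vr σ) p.2)).map (fun p => (p.1, p.1 + p.2)) := by
    rw [← prod_withDensity_right hg, ← gaussianReal_of_var_ne_zero 0 (vr_ne hσ)]
    rfl
  rw [h1]
  refine Measure.ext_of_lintegral _ fun F hF => ?_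
  rw [lintegral_map hF (by fun_prop), lintegral_withDensity_eq_lintegral_mul _ (by fun_prop)
    (by fun_prop), lintegral_withDensity_eq_lintegral_mul _ hm hF,
    ← (measurePreserving_prod_add Q volume).lintegral_comp (hm.mul hF)]
  simp

/-- output density -/
noncomputable def fY (σ : ℝ) (Q : Measure ℝ) (y : ℝ) : ENNReal :=
  ∫⁻ x, gaussianPDF 0 (vr σ) (y - x) ∂Q

lemma fY_meas [IsProbabilityMeasure Q] : Measurable (fY σ Q) := by
  have hg := measurable_gaussianPDF 0 (vr σ)
  exact Measurable.lintegral_prod_right' (f := fun p : ℝ × ℝ => gaussianPDF 0 (vr σ) (p.1 - p.2))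
    (by fun_prop)

lemma fY_ne_zero (hσ : 0 < σ) [IsProbabilityMeasure Q] (y : ℝ) : fY σ Q y ≠ 0 := by
  have hg := measurable_gaussianPDF 0 (vr σ)
  intro h
  rw [fY, lintegral_eq_zero_iff (by fun_prop)] at h
  obtain ⟨x, hx⟩ := h.exists
  exact (gaussianPDF_pos 0 (vr_ne hσ) (y - x)).ne' hx

lemma fY_ne_top [IsProbabilityMeasure Q] (y : ℝ) : fY σ Q y ≠ ⊤ := by
  have : fY σ Q y ≤ ∫⁻ _, ENNReal.ofReal ((√(2 * π * vr σ))⁻¹) ∂Q := by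
    refine lintegral_mono fun x => ENNReal.ofReal_le_ofReal ?_
    rw [gaussianPDFReal]
    refine mul_le_of_le_one_right (by positivity) (Real.exp_le_one_iff.2 ?_)
    rw [neg_div]
    exact neg_nonpos.2 (by positivity)
  refine ne_top_of_le_ne_top ?_ this
  rw [lintegral_const, measure_univ, mul_one]
  exact ENNReal.ofReal_ne_top

lemma joint_fst [IsProbabilityMeasure Q] : (jointLaw σ Q).map Prod.fst = Q := by
  rw [jointLaw_eq, Measure.map_map (by fun_prop) (by fun_prop)]
  change Measure.map Prod.fst _ = Q
  exact (measurePreserving_fst).map_eq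

lemma joint_snd (hσ : 0 < σ) [IsProbabilityMeasure Q] :
    (jointLaw σ Q).map Prod.snd = volume.withDensity (fY σ Q) := by
  have hg := measurable_gaussianPDF 0 (vr σ)
  refine Measure.ext_of_lintegral _ fun F hF => ?_
  rw [lintegral_map hF (by fun_prop), joint_density hσ,
    lintegral_withDensity_eq_lintegral_mul _ (by fun_prop) (by fun_prop),
    lintegral_withDensity_eq_lintegral_mul _ fY_meas hF,
    lintegral_prod_symm' _ (by fun_prop)]
  refine lintegral_congr fun y => ?_
  simp only [Pi.mul_apply]
  rw [lintegral_mul_const _ (by fun_prop)]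
  rfl

instance [IsProbabilityMeasure Q] : IsProbabilityMeasure (jointLaw σ Q) := by
  rw [jointLaw_eq]
  exact Measure.isProbabilityMeasure_map (by fun_prop)

lemma fY_lintegral (hσ : 0 < σ) [IsProbabilityMeasure Q] : ∫⁻ y, fY σ Q y = 1 := by
  have h := joint_snd (Q := Q) hσ
  have : IsProbabilityMeasure ((jointLaw σ Q).map Prod.snd) :=
    Measure.isProbabilityMeasure_map (by fun_prop)
  have h2 := measure_univ (μ := (jointLaw σ Q).map Prod.snd)
  rw [h] at h2
  simpa using h2

lemma llr_joint (hσ : 0 < σ) [IsProbabilityMeasure Q] :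
    ∀ᵐ p ∂(jointLaw σ Q),
      llr (jointLaw σ Q) (((jointLaw σ Q).map Prod.fst).prod ((jointLaw σ Q).map Prod.snd)) p =
        log (gaussianPDFReal 0 (vr σ) (p.2 - p.1)) - log (fY σ Q p.2).toReal := by
  have hg := measurable_gaussianPDF 0 (vr σ)
  have hf := fY_meas (σ := σ) (Q := Q)
  set R := ((jointLaw σ Q).map Prod.fst).prod ((jointLaw σ Q).map Prod.snd) with hR
  have hp1 : IsProbabilityMeasure ((jointLaw σ Q).map Prod.fst) :=
    Measure.isProbabilityMeasure_map (by fun_prop)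
  have hp2 : IsProbabilityMeasure ((jointLaw σ Q).map Prod.snd) :=
    Measure.isProbabilityMeasure_map (by fun_prop)
  have hR' : R = (Q.prod volume).withDensity (fun p => fY σ Q p.2) := by
    rw [hR, joint_fst, joint_snd hσ, prod_withDensity_right hf]
  have hP : jointLaw σ Q =
      R.withDensity (fun p => gaussianPDF 0 (vr σ) (p.2 - p.1) / fY σ Q p.2) := by
    rw [hR', ← withDensity_mul _ (by fun_prop) (by fun_prop), joint_density hσ]
    congr 1
    funext p
    simp only [Pi.mul_apply]
    rw [ENNReal.mul_div_cancel (fY_ne_zero hσ _) (fY_ne_top _)]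
  have hac : jointLaw σ Q ≪ R := by rw [hP]; exact withDensity_absolutelyContinuous _ _
  have hrn := Measure.rnDeriv_withDensity R
    (f := fun p => gaussianPDF 0 (vr σ) (p.2 - p.1) / fY σ Q p.2) (by fun_prop)
  rw [← hP] at hrn
  filter_upwards [hac.ae_le hrn] with p hp
  rw [llr, hp, ENNReal.toReal_div, toReal_gaussianPDF, log_div]
  · exact (gaussianPDFReal_pos _ _ _ (vr_ne hσ)).ne'
  · exact (ENNReal.toReal_pos (fY_ne_zero hσ _) (fY_ne_top _)).ne'

end density

section main

/-- the Gaussian pair law -/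
noncomputable def M : Measure (ℝ × ℝ) := (gaussianReal 0 1).prod (gaussianReal 0 1)

instance : IsProbabilityMeasure M := by unfold M; infer_instance

/-- the input law (exponential with mean E) -/
noncomputable def QE (E : ℝ) : Measure ℝ := (gaussianReal 0 1).map (fun a => E * nl a)

instance (E : ℝ) : IsProbabilityMeasure (QE E) :=
  Measure.isProbabilityMeasure_map ((nl_cont.measurable.const_mul E).aemeasurable)

/-- first rotated coordinate -/
noncomputable def ru (θ : ℝ) (p : ℝ × ℝ) : ℝ := cos θ * p.1 + sin θ * p.2
/-- second rotated coordinate -/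
noncomputable def rv (θ : ℝ) (p : ℝ × ℝ) : ℝ := - sin θ * p.1 + cos θ * p.2

lemma rot_mp (θ : ℝ) : MeasurePreserving (fun p => (ru θ p, rv θ p)) M M := by
  refine ⟨by unfold ru rv; fun_prop, ?_⟩
  exact IsGaussian.map_rotation_eq_self (μ := gaussianReal 0 1) (by simp) θ

lemma fst_mp : MeasurePreserving (fun p : ℝ × ℝ => p.1) M (gaussianReal 0 1) :=
  measurePreserving_fst

lemma snd_mp : MeasurePreserving (fun p : ℝ × ℝ => p.2) M (gaussianReal 0 1) :=
  measurePreserving_snd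

lemma ru_mp (θ : ℝ) : MeasurePreserving (ru θ) M (gaussianReal 0 1) :=
  fst_mp.comp (rot_mp θ)

lemma rv_mp (θ : ℝ) : MeasurePreserving (rv θ) M (gaussianReal 0 1) :=
  snd_mp.comp (rot_mp θ)

lemma mp_integral {f : ℝ × ℝ → ℝ} (hf : MeasurePreserving f M (gaussianReal 0 1)) {g : ℝ → ℝ}
    (hg : Continuous g) : ∫ p, g (f p) ∂M = ∫ x, g x ∂(gaussianReal 0 1) := by
  rw [← hf.map_eq, integral_map hf.measurable.aemeasurable hg.aestronglyMeasurable]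

lemma mp_integrable {f : ℝ × ℝ → ℝ} (hf : MeasurePreserving f M (gaussianReal 0 1)) {g : ℝ → ℝ}
    (hg : Integrable g (gaussianReal 0 1)) : Integrable (fun p => g (f p)) M :=
  hf.integrable_comp_of_integrable hg

/-- pair (input, output) in rotated coordinates -/
noncomputable def Psi (σ E θ : ℝ) (p : ℝ × ℝ) : ℝ × ℝ :=
  (E * nl (ru θ p), E * nl (ru θ p) + σ * rv θ p)

lemma ru_meas (θ : ℝ) : Measurable (ru θ) := by unfold ru; fun_prop
lemma rv_meas (θ : ℝ) : Measurable (rv θ) := by unfold rv; fun_prop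

lemma Psi_meas (σ E θ : ℝ) : Measurable (Psi σ E θ) := by
  have := nl_cont.measurable
  have h1 := ru_meas θ
  have h2 := rv_meas θ
  unfold Psi; fun_prop

lemma joint_eq_map (σ E θ : ℝ) : jointLaw σ (QE E) = M.map (Psi σ E θ) := by
  have hn := nl_cont.measurable
  have hg : gaussianReal 0 (vr σ) = (gaussianReal 0 1).map (fun b => σ * b) := by
    have := gaussianReal_map_const_mul (μ := 0) (v := 1) σ
    rw [mul_zero, mul_one] at this
    exact this.symm
  have h1 : M.map (Psi σ E θ) = (M.map (fun p => (ru θ p, rv θ p))).map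
      (fun p => (E * nl p.1, E * nl p.1 + σ * p.2)) := by
    rw [Measure.map_map (by fun_prop) (rot_mp θ).measurable]; rfl
  rw [h1, (rot_mp θ).map_eq, jointLaw_eq, QE, hg, Measure.map_prod_map _ _ (by fun_prop) (by fun_prop),
    Measure.map_map (by fun_prop) (by fun_prop)]
  rfl

/-- absolute Jacobian -/
noncomputable def Jac (σ E θ : ℝ) (p : ℝ × ℝ) : ℝ :=
  cos θ * (E * (phi (ru θ p) / Phi (ru θ p))) + sin θ * σ

lemma Jac_pos {σ E θ : ℝ} (hσ : 0 < σ) (hE : 0 < E) (hc : 0 < cos θ) (hs : 0 < sin θ)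
    (p : ℝ × ℝ) : 0 < Jac σ E θ p := by
  have := phi_pos (ru θ p)
  have := Phi_pos (ru θ p)
  unfold Jac; positivity

lemma Jac_meas (σ E θ : ℝ) : Measurable (Jac σ E θ) := by
  have := phi_cont.measurable
  have := Phi_cont.measurable
  have := ru_meas θ
  unfold Jac; fun_prop

lemma Psi_deriv (σ E θ w x : ℝ) :
    HasDerivAt (fun x => (Psi σ E θ (x, w)).2) (- Jac σ E θ (x, w)) x := by
  have h1 : HasDerivAt (fun x : ℝ => ru θ (x, w)) (cos θ) x := by
    have := ((hasDerivAt_id x).const_mul (cos θ)).add_const (sin θ * w)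
    simpa [ru] using this
  have h2 : HasDerivAt (fun x : ℝ => rv θ (x, w)) (- sin θ) x := by
    have := ((hasDerivAt_id x).const_mul (- sin θ)).add_const (cos θ * w)
    simpa [rv] using this
  have h3 := (((nl_deriv (ru θ (x, w))).comp x h1).const_mul E).add (h2.const_mul σ)
  convert! h3 using 1
  unfold Jac; ring

/-- the likelihood ratio variable -/
noncomputable def tt (σ E θ : ℝ) (p : ℝ × ℝ) : ℝ :=
  Jac σ E θ p * (fY σ (QE E) (Psi σ E θ p).2).toReal / phi p.1

lemma tt_meas (σ E θ : ℝ) : Measurable (tt σ E θ) := by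
  have := Jac_meas σ E θ
  have := phi_cont.measurable
  have := Psi_meas σ E θ
  have h4 : Measurable (fun p => (fY σ (QE E) (Psi σ E θ p).2).toReal) :=
    ((fY_meas (σ := σ) (Q := QE E)).comp (measurable_snd.comp (Psi_meas σ E θ))).ennreal_toReal
  unfold tt
  exact ((Jac_meas σ E θ).mul h4).div (by fun_prop)

lemma tt_pos {σ E θ : ℝ} (hσ : 0 < σ) (hE : 0 < E) (hc : 0 < cos θ) (hs : 0 < sin θ)
    (p : ℝ × ℝ) : 0 < tt σ E θ p := by
  have := Jac_pos hσ hE hc hs p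
  have := phi_pos p.1
  have := ENNReal.toReal_pos (fY_ne_zero (Q := QE E) hσ (Psi σ E θ p).2) (fY_ne_top _)
  unfold tt; positivity

lemma tt_lintegral {σ E θ : ℝ} (hσ : 0 < σ) (hE : 0 < E) (hc : 0 < cos θ) (hs : 0 < sin θ) :
    ∫⁻ p, ENNReal.ofReal (tt σ E θ p) ∂M ≤ 1 := by
  have htm := tt_meas σ E θ
  have hphi := phi_cont.measurable
  rw [M, lintegral_prod_symm' _ (by fun_prop)]
  have key : ∀ w, ∫⁻ x, ENNReal.ofReal (tt σ E θ (x, w)) ∂(gaussianReal 0 1) ≤ 1 := by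
    intro w
    rw [gauss_eq, lintegral_withDensity_eq_lintegral_mul _ (by fun_prop) (by fun_prop)]
    have hanti : StrictAnti (fun x => (Psi σ E θ (x, w)).2) :=
      strictAnti_of_deriv_neg fun x => by
        rw [(Psi_deriv σ E θ w x).deriv]
        have := Jac_pos hσ hE hc hs (x, w)
        linarith
    have hcv := lintegral_image_eq_lintegral_abs_deriv_mul (s := univ) MeasurableSet.univ
      (fun x _ => (Psi_deriv σ E θ w x).hasDerivWithinAt) hanti.injective.injOn (fY σ (QE E))
    rw [setLIntegral_univ] at hcv
    have heq : ∀ x, ((fun x => ENNReal.ofReal (phi x)) *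
        fun x => ENNReal.ofReal (tt σ E θ (x, w))) x =
        ENNReal.ofReal |-Jac σ E θ (x, w)| * fY σ (QE E) (Psi σ E θ (x, w)).2 := by
      intro x
      have hp := phi_pos x
      have hJ := Jac_pos hσ hE hc hs (x, w)
      simp only [Pi.mul_apply]
      rw [← ENNReal.ofReal_mul hp.le, abs_neg, abs_of_pos hJ, tt]
      rw [mul_div_cancel₀ _ hp.ne', ENNReal.ofReal_mul hJ.le, ENNReal.ofReal_toReal (fY_ne_top _)]
    rw [lintegral_congr heq, ← hcv]
    exact (setLIntegral_le_lintegral _ _).trans (fY_lintegral hσ).le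
  calc _ ≤ ∫⁻ _, 1 ∂(gaussianReal 0 1) := lintegral_mono key
    _ = 1 := by simp

lemma tt_integrable {σ E θ : ℝ} (hσ : 0 < σ) (hE : 0 < E) (hc : 0 < cos θ) (hs : 0 < sin θ) :
    Integrable (tt σ E θ) M :=
  (lintegral_ofReal_ne_top_iff_integrable (tt_meas σ E θ).aestronglyMeasurable
    (ae_of_all _ fun p => (tt_pos hσ hE hc hs p).le)).1
    (ne_top_of_le_ne_top ENNReal.one_ne_top (tt_lintegral hσ hE hc hs))

lemma tt_integral {σ E θ : ℝ} (hσ : 0 < σ) (hE : 0 < E) (hc : 0 < cos θ) (hs : 0 < sin θ) :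
    ∫ p, tt σ E θ p ∂M ≤ 1 := by
  rw [integral_eq_lintegral_of_nonneg_ae (ae_of_all _ fun p => (tt_pos hσ hE hc hs p).le)
    (tt_meas σ E θ).aestronglyMeasurable]
  exact ENNReal.toReal_le_of_le_ofReal zero_le_one
    (by simpa using tt_lintegral hσ hE hc hs)

/-- integrable minorant -/
noncomputable def KK (σ E θ : ℝ) (p : ℝ × ℝ) : ℝ :=
  (- log σ + 1 + cos θ ^ 2 * (log E - 1 / 2 * log (2 * π) - log (cos θ))
    + sin θ ^ 2 * (log σ - log (sin θ)))
  + (p.1 ^ 2 * (1 / 2) - rv θ p ^ 2 * (1 / 2)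
    + (nl (ru θ p) * cos θ ^ 2 - ru θ p ^ 2 * (cos θ ^ 2 / 2)))

lemma KK_int (σ E θ : ℝ) : Integrable (KK σ E θ) M ∧ ∫ p, KK σ E θ p ∂M =
    - log σ + 1 + cos θ ^ 2 * (log E - 1 / 2 * log (2 * π) + 1 / 2 - log (cos θ))
    + sin θ ^ 2 * (log σ - log (sin θ)) := by
  have a1 := (mp_integrable fst_mp sq_int).mul_const (1 / 2)
  have a2 := (mp_integrable (rv_mp θ) sq_int).mul_const (1 / 2)
  have a3 := (mp_integrable (ru_mp θ) nl_int).mul_const (cos θ ^ 2)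
  have a4 := (mp_integrable (ru_mp θ) sq_int).mul_const (cos θ ^ 2 / 2)
  have b1 := mp_integral fst_mp (g := fun x => x ^ 2) (by fun_prop)
  have b2 := mp_integral (rv_mp θ) (g := fun x => x ^ 2) (by fun_prop)
  have b3 := mp_integral (ru_mp θ) nl_cont
  have b4 := mp_integral (ru_mp θ) (g := fun x => x ^ 2) (by fun_prop)
  rw [sq_integral] at b1 b2 b4
  rw [nl_integral] at b3
  have a12 : Integrable (fun p : ℝ × ℝ => p.1 ^ 2 * (1 / 2) - rv θ p ^ 2 * (1 / 2)) M := a1.sub a2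
  have a34 : Integrable (fun p => nl (ru θ p) * cos θ ^ 2 - ru θ p ^ 2 * (cos θ ^ 2 / 2)) M :=
    a3.sub a4
  have a14 : Integrable (fun p : ℝ × ℝ => p.1 ^ 2 * (1 / 2) - rv θ p ^ 2 * (1 / 2)
      + (nl (ru θ p) * cos θ ^ 2 - ru θ p ^ 2 * (cos θ ^ 2 / 2))) M := a12.add a34
  refine ⟨(integrable_const _).add a14, ?_⟩
  unfold KK
  rw [integral_add (integrable_const _) a14,
    integral_add a12 a34, integral_sub a1 a2, integral_sub a3 a4,
    integral_mul_const, integral_mul_const, integral_mul_const, integral_mul_const,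
    b1, b2, b3, b4, integral_const, probReal_univ, one_smul]
  ring

lemma log_Jac {σ E θ : ℝ} (hσ : 0 < σ) (hE : 0 < E) (hc : 0 < cos θ) (hs : 0 < sin θ)
    (p : ℝ × ℝ) : cos θ ^ 2 * (log E + log (phi (ru θ p)) + nl (ru θ p) - log (cos θ))
      + sin θ ^ 2 * (log σ - log (sin θ)) ≤ log (Jac σ E θ p) := by
  have h1 := phi_pos (ru θ p)
  have h2 := Phi_pos (ru θ p)
  set A := E * (phi (ru θ p) / Phi (ru θ p)) with hA
  have hA0 : 0 < A := by positivity
  have hlA : log A = log E + log (phi (ru θ p)) + nl (ru θ p) := by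
    rw [hA, log_mul hE.ne' (by positivity), log_div h1.ne' h2.ne', nl]; ring
  have hcc := strictConcaveOn_log_Ioi.concaveOn.2 (x := A / cos θ) (y := σ / sin θ)
    (Set.mem_Ioi.2 (by positivity)) (Set.mem_Ioi.2 (by positivity))
    (sq_nonneg (cos θ)) (sq_nonneg (sin θ)) (cos_sq_add_sin_sq θ)
  have e : cos θ ^ 2 * (A / cos θ) + sin θ ^ 2 * (σ / sin θ) = Jac σ E θ p := by
    rw [Jac, ← hA]; field_simp
  simp only [smul_eq_mul] at hcc
  rw [e, log_div hA0.ne' hc.ne', log_div hσ.ne' hs.ne', hlA] at hcc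
  exact hcc

lemma log_pdf {σ : ℝ} (hσ : 0 < σ) (v : ℝ) : log (gaussianPDFReal 0 (vr σ) (σ * v)) =
    - (1 / 2 * log (2 * π)) - log σ - v ^ 2 / 2 := by
  have h2 : (vr σ : ℝ) = σ ^ 2 := rfl
  rw [gaussianPDFReal, h2, log_mul (by positivity) (by positivity), log_exp, log_inv,
    log_sqrt (by positivity), log_mul (by positivity) (by positivity), log_pow]
  field_simp
  push_cast
  ring

lemma pointwise {σ E θ : ℝ} (hσ : 0 < σ) (hE : 0 < E) (hc : 0 < cos θ) (hs : 0 < sin θ)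
    (p : ℝ × ℝ) : KK σ E θ p ≤
      (log (gaussianPDFReal 0 (vr σ) ((Psi σ E θ p).2 - (Psi σ E θ p).1))
        - log (fY σ (QE E) (Psi σ E θ p).2).toReal) + tt σ E θ p := by
  have hd : (Psi σ E θ p).2 - (Psi σ E θ p).1 = σ * rv θ p := by simp [Psi]
  have hJ := Jac_pos hσ hE hc hs p
  have hf := ENNReal.toReal_pos (fY_ne_zero (Q := QE E) hσ (Psi σ E θ p).2) (fY_ne_top _)
  have h1 := log_le_sub_one_of_pos (tt_pos hσ hE hc hs p)
  have h2 : log (tt σ E θ p) = log (Jac σ E θ p) + log (fY σ (QE E) (Psi σ E θ p).2).toReal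
      - log (phi p.1) := by
    rw [tt, log_div (by positivity) (phi_pos _).ne', log_mul hJ.ne' hf.ne']
  have h3 := log_Jac hσ hE hc hs p
  rw [log_phi] at h2 h3
  rw [hd, log_pdf hσ, KK]
  linarith

lemma main_bound {σ E θ : ℝ} (hσ : 0 < σ) (hE : 0 < E) (hc : 0 < cos θ) (hs : 0 < sin θ) :
    ((- log σ + cos θ ^ 2 * (log E - 1 / 2 * log (2 * π) + 1 / 2 - log (cos θ))
    + sin θ ^ 2 * (log σ - log (sin θ)) : ℝ) : EReal) ≤ mutualInfo σ (QE E) := by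
  have hl := llr_joint (Q := QE E) hσ
  unfold mutualInfo klDiv
  split_ifs with h
  · obtain ⟨-, hint⟩ := h
    rw [EReal.coe_le_coe_iff]
    set L := llr (jointLaw σ (QE E)) (((jointLaw σ (QE E)).map Prod.fst).prod
      ((jointLaw σ (QE E)).map Prod.snd))
    rw [joint_eq_map σ E θ] at hl hint ⊢
    have hPm := (Psi_meas σ E θ).aemeasurable (μ := M)
    rw [integral_map hPm hint.1]
    have hint2 : Integrable (fun p => L (Psi σ E θ p)) M := hint.comp_aemeasurable hPm
    have hl2 := ae_of_ae_map hPm hl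
    obtain ⟨hK, hKi⟩ := KK_int σ E θ
    have hle : ∫ p, KK σ E θ p ∂M ≤ ∫ p, (L (Psi σ E θ p) + tt σ E θ p) ∂M := by
      refine integral_mono_ae hK (hint2.add (tt_integrable hσ hE hc hs)) ?_
      filter_upwards [hl2] with p hp
      rw [hp]
      exact pointwise hσ hE hc hs p
    rw [integral_add hint2 (tt_integrable hσ hE hc hs), hKi] at hle
    have := tt_integral hσ hE hc hs
    linarith
  · exact le_top

lemma QE_mem {E : ℝ} (hE : 0 < E) : QE E ∈ {Q : Measure ℝ | IsProbabilityMeasure Q ∧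
    Q (Set.Ici 0) = 1 ∧ ∫⁻ x, ENNReal.ofReal x ∂Q ≤ ENNReal.ofReal E} := by
  have hm : Measurable (fun a => E * nl a) := nl_cont.measurable.const_mul E
  refine ⟨inferInstance, ?_, ?_⟩
  · rw [QE, Measure.map_apply hm measurableSet_Ici]
    have : (fun a => E * nl a) ⁻¹' Ici 0 = univ :=
      eq_univ_of_forall fun a => mul_nonneg hE.le (nl_nonneg a)
    rw [this, measure_univ]
  · rw [QE, lintegral_map (by fun_prop) hm, ← ofReal_integral_eq_lintegral_ofReal
      (nl_int.const_mul E) (ae_of_all _ fun a => mul_nonneg hE.le (nl_nonneg a)),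
      integral_const_mul, nl_integral, mul_one]

end main

end CapAux

/-- Lower bound on the average-power-constrained capacity:
`C(E) ≥ (1/2) log(1 + E²e/(2πσ²))`. -/
theorem capacityAvg_lower_bound (σ E : ℝ) (hσ : 0 < σ) (hE : 0 < E) :
    ((1 / 2 * Real.log (1 + E ^ 2 * rexp 1 / (2 * π * σ ^ 2)) : ℝ) : EReal) ≤
      capacityAvg σ E := by
  have hπ := Real.pi_pos
  set τ : ℝ := E * √(rexp 1 / (2 * π)) with hτ
  have hτ0 : 0 < τ := by positivity
  have hτ2 : τ ^ 2 = E ^ 2 * (rexp 1 / (2 * π)) := by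
    rw [hτ, mul_pow, Real.sq_sqrt (by positivity)]
  have hlτ : Real.log τ = Real.log E - 1 / 2 * Real.log (2 * π) + 1 / 2 := by
    rw [hτ, Real.log_mul hE.ne' (by positivity), Real.log_sqrt (by positivity),
      Real.log_div (by positivity) (by positivity), Real.log_exp]
    ring
  set θ := Real.arctan (σ / τ) with hθ
  set r : ℝ := √(τ ^ 2 + σ ^ 2) with hr
  have hr0 : 0 < r := by positivity
  have hq : √(1 + (σ / τ) ^ 2) = r / τ := by
    rw [Real.sqrt_eq_iff_eq_sq (by positivity) (by positivity), div_pow, div_pow, hr,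
      Real.sq_sqrt (by positivity)]
    field_simp
  have hc : Real.cos θ = τ / r := by
    rw [hθ, Real.cos_arctan, hq]; field_simp
  have hs : Real.sin θ = σ / r := by
    rw [hθ, Real.sin_arctan, hq]; field_simp
  have hb := CapAux.main_bound (θ := θ) hσ hE (by rw [hc]; positivity) (by rw [hs]; positivity)
  refine le_trans (le_of_eq ?_) (hb.trans (le_iSup₂_of_le (CapAux.QE E) (CapAux.QE_mem hE) le_rfl))
  congr 1
  have h1 := Real.cos_sq_add_sin_sq θ
  have e1 : Real.log E - 1 / 2 * Real.log (2 * π) + 1 / 2 - Real.log (Real.cos θ) =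
      Real.log r := by
    rw [hc, Real.log_div hτ0.ne' hr0.ne', hlτ]; ring
  have e2 : Real.log σ - Real.log (Real.sin θ) = Real.log r := by
    rw [hs, Real.log_div hσ.ne' hr0.ne']; ring
  rw [e1, e2]
  have e3 : 1 + E ^ 2 * rexp 1 / (2 * π * σ ^ 2) = (τ ^ 2 + σ ^ 2) / σ ^ 2 := by
    rw [hτ2]; field_simp; ring
  have e4 : Real.log r = 1 / 2 * Real.log (τ ^ 2 + σ ^ 2) := by
    rw [hr, Real.log_sqrt (by positivity)]; ring
  rw [e3, Real.log_div (by positivity) (by positivity), Real.log_pow]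
  push_cast
  linear_combination (-Real.log r) * h1 - e4
end
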